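/- arXiv:1305.2052 — 5 statements merged into one kernel-verified Lean document; each statement's English description precedes it below -/
import Mathlib

section
/- Let g ≥ 2. Define p : ⋀²H → ⋀²H by p(ω) := ω − (Φ(ω)/g)·θ (so p(ω) ∈ Λ²₀H for all ω), and let φ̂ : ⋀⁴H → ⋀²H ⊗ ⋀²H be the unique ℚ-linear map such that for all x₁,x₂,x₃,x₄ ∈ H: φ̂(x₁∧x₂∧x₃∧x₄) = p(x₁∧x₂)⊗p(x₃∧x₄) + p(x₃∧x₄)⊗p(x₁∧x₂) − p(x₁∧x₃)⊗p(x₂∧x₄) − p(x₂∧x₄)⊗p(x₁∧x₃) + p(x₁∧x₄)⊗p(x₂∧x₃) + p(x₂∧x₃)⊗p(x₁∧x₄); such a map exists and is unique because the right-hand side is alternating multilinear in (x₁,x₂,x₃,x₄). Then φ̂ is injective. (This is the injectivity of the Sp(H)-module map φ : ⋀⁴H → S²Λ²₀H of the paper, with the symmetric square realized inside the tensor square.) -/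
noncomputable section

open scoped TensorProduct

/-- `H = ℚ^{2g}`, where `Sum.inl i` indexes the basis vector `aᵢ` and `Sum.inr i`
indexes the basis vector `bᵢ`. -/
abbrev H (g : ℕ) : Type := (Fin g ⊕ Fin g) → ℚ

/-- The basis vector `aᵢ` of `H`. -/
def aa (g : ℕ) (i : Fin g) : H g := Pi.single (Sum.inl i) 1

/-- The basis vector `bᵢ` of `H`. -/
def bb (g : ℕ) (i : Fin g) : H g := Pi.single (Sum.inr i) 1

/-- The standard symplectic form on `H`, with `⟨aᵢ,aⱼ⟩ = ⟨bᵢ,bⱼ⟩ = 0` and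
`⟨aᵢ,bⱼ⟩ = δᵢⱼ = -⟨bⱼ,aᵢ⟩`. -/
def symp (g : ℕ) (x y : H g) : ℚ :=
  ∑ i : Fin g, (x (Sum.inl i) * y (Sum.inr i) - x (Sum.inr i) * y (Sum.inl i))

/-- The canonical inclusion `H → ⋀H` into the exterior algebra. -/
abbrev ιE (g : ℕ) : H g →ₗ[ℚ] ExteriorAlgebra ℚ (H g) := ExteriorAlgebra.ι ℚ

/-- `θ = Σᵢ aᵢ ∧ bᵢ ∈ ⋀²H`. -/
def θE (g : ℕ) : ExteriorAlgebra ℚ (H g) :=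
  ∑ i : Fin g, ιE g (aa g i) * ιE g (bb g i)

/-- the contraction operator -/
def cD (g : ℕ) (k : Fin g ⊕ Fin g) : Module.Dual ℚ (H g) := LinearMap.proj k

def cC (g : ℕ) : ExteriorAlgebra ℚ (H g) →ₗ[ℚ] ExteriorAlgebra ℚ (H g) :=
  ∑ i : Fin g, (CliffordAlgebra.contractLeft (Q := (0 : QuadraticForm ℚ (H g))) (cD g (Sum.inr i))) ∘ₗ
    (CliffordAlgebra.contractLeft (Q := (0 : QuadraticForm ℚ (H g))) (cD g (Sum.inl i)))

theorem ctr_mul (g : ℕ) (d : Module.Dual ℚ (H g)) (u : H g) (y : ExteriorAlgebra ℚ (H g)) :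
    CliffordAlgebra.contractLeft (Q := (0 : QuadraticForm ℚ (H g))) d (ιE g u * y) =
     d u • y - ιE g u * CliffordAlgebra.contractLeft (Q := (0 : QuadraticForm ℚ (H g))) d y :=
  CliffordAlgebra.contractLeft_ι_mul d u y

theorem ctr_unit (g : ℕ) (d : Module.Dual ℚ (H g)) :
    CliffordAlgebra.contractLeft (Q := (0 : QuadraticForm ℚ (H g))) d
    (1 : ExteriorAlgebra ℚ (H g)) = 0 := CliffordAlgebra.contractLeft_one _ d

theorem ctr_one (g : ℕ) (d : Module.Dual ℚ (H g)) (u : H g) :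
    CliffordAlgebra.contractLeft (Q := (0 : QuadraticForm ℚ (H g))) d (ιE g u) =
     d u • (1 : ExteriorAlgebra ℚ (H g)) := by
  have := ctr_mul g d u 1
  rw [mul_one] at this
  rw [this]
  have h : CliffordAlgebra.contractLeft (Q := (0 : QuadraticForm ℚ (H g))) d
    (1 : ExteriorAlgebra ℚ (H g)) = 0 := CliffordAlgebra.contractLeft_one _ d
  rw [h, mul_zero, sub_zero]

theorem cC4 (g : ℕ) (u v w z : H g) :
    cC g (ιE g u * ιE g v * ιE g w * ιE g z) =
      symp g u v • (ιE g w * ιE g z) - symp g u w • (ιE g v * ιE g z)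
      + symp g u z • (ιE g v * ιE g w) + symp g v w • (ιE g u * ιE g z)
      - symp g v z • (ιE g u * ιE g w) + symp g w z • (ιE g u * ιE g v) := by
  simp only [mul_assoc, cC, LinearMap.sum_apply, LinearMap.comp_apply, ctr_mul, ctr_one, ctr_unit, mul_zero, smul_zero, sub_zero, map_sub,
    map_smul, symp, Finset.sum_smul, ← Finset.sum_add_distrib, ← Finset.sum_sub_distrib]
  refine Finset.sum_congr rfl fun i _ => ?_
  simp only [cD, LinearMap.proj_apply, mul_sub, mul_smul_comm, mul_one, smul_sub, sub_smul]
  module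

theorem anti (g : ℕ) (u v : H g) : ιE g u * ιE g v = - (ιE g v * ιE g u) := by
  rw [eq_neg_iff_add_eq_zero]
  exact ExteriorAlgebra.ι_add_mul_swap u v

theorem anti3 (g : ℕ) (u v : H g) (y : ExteriorAlgebra ℚ (H g)) :
    ιE g u * (ιE g v * y) = - (ιE g v * (ιE g u * y)) := by
  rw [← mul_assoc, anti, neg_mul, mul_assoc]

theorem comm2 (g : ℕ) (u v w z : H g) :
    (ιE g w * ιE g z) * (ιE g u * ιE g v) = (ιE g u * ιE g v) * (ιE g w * ιE g z) := by
  simp only [mul_assoc]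
  rw [anti3 g z u, mul_neg, anti3 g w u, neg_neg, anti g z v, mul_neg, anti3 g w v, mul_neg, mul_neg,
    neg_neg]

theorem θ_comm (g : ℕ) (u v : H g) :
    (ιE g u * ιE g v) * θE g = θE g * (ιE g u * ιE g v) := by
  simp only [θE, Finset.mul_sum, Finset.sum_mul]
  exact Finset.sum_congr rfl fun i _ => comm2 g _ _ _ _

theorem symp_a (g : ℕ) (j : Fin g) (u : H g) : symp g (aa g j) u = u (Sum.inr j) := by
  simp [symp, aa, Pi.single_apply]

theorem symp_b (g : ℕ) (j : Fin g) (u : H g) : symp g (bb g j) u = - u (Sum.inl j) := by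
  simp [symp, bb, Pi.single_apply]

theorem expand (g : ℕ) (u : H g) :
    ιE g u = ∑ j : Fin g, (u (Sum.inl j) • ιE g (aa g j) + u (Sum.inr j) • ιE g (bb g j)) := by
  have h : u = ∑ j : Fin g, (u (Sum.inl j) • aa g j + u (Sum.inr j) • bb g j) := by
    ext k
    rcases k with k | k <;> simp [aa, bb, Pi.single_apply, Finset.sum_apply]
  conv_lhs => rw [h]
  simp only [map_sum, map_add, map_smul]

theorem cCθ (g : ℕ) (u v : H g) :
    cC g (θE g * (ιE g u * ιE g v)) =
      ((g : ℚ) - 2) • (ιE g u * ιE g v) + symp g u v • θE g := by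
  have key : cC g (θE g * (ιE g u * ιE g v)) =
      (g : ℚ) • (ιE g u * ιE g v) - ιE g u * ιE g v + ιE g v * ιE g u + symp g u v • θE g := by
    have e1 : ιE g u * ιE g v = ∑ j : Fin g, (u (Sum.inl j) • (ιE g (aa g j) * ιE g v)
        + u (Sum.inr j) • (ιE g (bb g j) * ιE g v)) := by
      conv_lhs => rw [expand g u]
      simp only [Finset.sum_mul, add_mul, smul_mul_assoc]
    have e2 : ιE g v * ιE g u = ∑ j : Fin g, (v (Sum.inl j) • (ιE g (aa g j) * ιE g u)
        + v (Sum.inr j) • (ιE g (bb g j) * ιE g u)) := by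
      conv_lhs => rw [expand g v]
      simp only [Finset.sum_mul, add_mul, smul_mul_assoc]
    have e3 : (g : ℚ) • (ιE g u * ιE g v) = ∑ j : Fin g, (ιE g u * ιE g v) := by
      simp [Nat.cast_smul_eq_nsmul]
    rw [e3, e2]
    conv_rhs => enter [1, 1, 2]; rw [e1]
    rw [θE, Finset.sum_mul, map_sum, Finset.smul_sum, ← Finset.sum_sub_distrib,
      ← Finset.sum_add_distrib, ← Finset.sum_add_distrib]
    refine Finset.sum_congr rfl fun j _ => ?_
    rw [← mul_assoc, cC4]
    simp only [symp_a, symp_b]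
    have : bb g j (Sum.inr j) = 1 := by simp [bb]
    rw [this]
    module
  rw [key, anti g v u]
  module

theorem Φθ (g : ℕ) (Φ : ExteriorAlgebra ℚ (H g) →ₗ[ℚ] ℚ)
    (hΦ : ∀ u v : H g, Φ (ιE g u * ιE g v) = symp g u v) : Φ (θE g) = g := by
  simp [θE, hΦ, symp_a, bb]

theorem cCθθ (g : ℕ) : cC g (θE g * θE g) = (2 * (g : ℚ) - 2) • θE g := by
  conv_lhs => enter [2, 2]; rw [θE]
  rw [Finset.mul_sum, map_sum]
  simp only [cCθ, Finset.sum_add_distrib, ← Finset.smul_sum, symp_a]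
  have : ∀ j, bb g j (Sum.inr j) = 1 := by simp [bb]
  simp only [this, one_smul, Finset.sum_const, Finset.card_univ, Fintype.card_fin]
  rw [← θE, ← Nat.cast_smul_eq_nsmul ℚ]
  module

theorem span4 (g : ℕ) {M : Type*} [AddCommGroup M] [Module ℚ M]
    (f h : ExteriorAlgebra ℚ (H g) →ₗ[ℚ] M)
    (hfh : ∀ x₁ x₂ x₃ x₄ : H g, f (ιE g x₁ * ιE g x₂ * ιE g x₃ * ιE g x₄) =
      h (ιE g x₁ * ιE g x₂ * ιE g x₃ * ιE g x₄)) :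
    ∀ x ∈ (⋀[ℚ]^4 (H g) : Submodule ℚ (ExteriorAlgebra ℚ (H g))), f x = h x := by
  intro x hx
  rw [← ExteriorAlgebra.ιMulti_span_fixedDegree] at hx
  refine LinearMap.eqOn_span (f := f) (g := h) ?_ hx
  rintro _ ⟨v, rfl⟩
  have := hfh (v 0) (v 1) (v 2) (v 3)
  have e : ExteriorAlgebra.ιMulti ℚ 4 v =
      ιE g (v 0) * ιE g (v 1) * ιE g (v 2) * ιE g (v 3) := by
    simp only [ExteriorAlgebra.ιMulti_apply, List.ofFn_succ, List.ofFn_zero, List.prod_cons,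
      List.prod_nil, mul_one, mul_assoc]
    rfl
  rw [e]
  exact this

/-- Let `g ≥ 2`, let `Φ : ⋀²H → ℚ` be the unique linear map with `Φ(u∧v) = ⟨u,v⟩`,
let `p(ω) = ω − (Φ(ω)/g)·θ` (the projection of `⋀²H` onto `Λ²₀H = ker Φ`), and let
`φ̂ : ⋀⁴H → ⋀²H ⊗ ⋀²H` be the unique linear map with
`φ̂(x₁∧x₂∧x₃∧x₄) = p(x₁∧x₂)⊗p(x₃∧x₄) + p(x₃∧x₄)⊗p(x₁∧x₂) − p(x₁∧x₃)⊗p(x₂∧x₄)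
 − p(x₂∧x₄)⊗p(x₁∧x₃) + p(x₁∧x₄)⊗p(x₂∧x₃) + p(x₂∧x₃)⊗p(x₁∧x₄)`.
Then `φ̂` is injective (on `⋀⁴H`). -/
theorem phi_hat_injective (g : ℕ) (hg : 2 ≤ g)
    (Φ : ExteriorAlgebra ℚ (H g) →ₗ[ℚ] ℚ)
    (hΦ : ∀ u v : H g, Φ (ιE g u * ιE g v) = symp g u v)
    (φhat : ExteriorAlgebra ℚ (H g) →ₗ[ℚ]
      ExteriorAlgebra ℚ (H g) ⊗[ℚ] ExteriorAlgebra ℚ (H g))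
    (hφhat : ∀ x₁ x₂ x₃ x₄ : H g,
      let p : ExteriorAlgebra ℚ (H g) → ExteriorAlgebra ℚ (H g) :=
        fun ω => ω - (Φ ω / (g : ℚ)) • θE g
      φhat (ιE g x₁ * ιE g x₂ * ιE g x₃ * ιE g x₄) =
        p (ιE g x₁ * ιE g x₂) ⊗ₜ[ℚ] p (ιE g x₃ * ιE g x₄)
          + p (ιE g x₃ * ιE g x₄) ⊗ₜ[ℚ] p (ιE g x₁ * ιE g x₂)
          - p (ιE g x₁ * ιE g x₃) ⊗ₜ[ℚ] p (ιE g x₂ * ιE g x₄)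
          - p (ιE g x₂ * ιE g x₄) ⊗ₜ[ℚ] p (ιE g x₁ * ιE g x₃)
          + p (ιE g x₁ * ιE g x₄) ⊗ₜ[ℚ] p (ιE g x₂ * ιE g x₃)
          + p (ιE g x₂ * ιE g x₃) ⊗ₜ[ℚ] p (ιE g x₁ * ιE g x₄)) :
    Set.InjOn φhat (⋀[ℚ]^4 (H g) : Submodule ℚ (ExteriorAlgebra ℚ (H g))) := by
  have hg0 : (g : ℚ) ≠ 0 := by
    have : g ≠ 0 := by omega
    exact_mod_cast this
  have hI := span4 g ((LinearMap.mul' ℚ (ExteriorAlgebra ℚ (H g))) ∘ₗ φhat)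
    ((6 : ℚ) • LinearMap.id - (2 / (g : ℚ)) • (LinearMap.mulLeft ℚ (θE g) ∘ₗ cC g)
      + (1 / (g : ℚ) ^ 2) • ((Φ ∘ₗ cC g).smulRight (θE g * θE g))) (by
    intro u v w z
    have h := hφhat u v w z
    simp only at h
    rw [LinearMap.comp_apply, h]
    simp only [map_add, map_sub, LinearMap.mul'_apply, LinearMap.add_apply, LinearMap.sub_apply,
      LinearMap.smul_apply, LinearMap.id_apply, LinearMap.comp_apply, LinearMap.mulLeft_apply,
      LinearMap.smulRight_apply, cC4, map_smul, hΦ, smul_eq_mul]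
    simp only [mul_sub, sub_mul, mul_add, smul_mul_assoc, mul_smul_comm, θ_comm]
    have c1 := comm2 g u v w z
    have c2 : (ιE g u * ιE g w) * (ιE g v * ιE g z) = - ((ιE g u * ιE g v) * (ιE g w * ιE g z)) := by
      simp only [mul_assoc]
      rw [anti3 g w v, mul_neg]
    have c2' : (ιE g v * ιE g z) * (ιE g u * ιE g w) = - ((ιE g u * ιE g v) * (ιE g w * ιE g z)) := by
      rw [comm2, c2]
    have c3 : (ιE g v * ιE g w) * (ιE g u * ιE g z) = (ιE g u * ιE g v) * (ιE g w * ιE g z) := by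
      simp only [mul_assoc]
      rw [anti3 g w u, mul_neg, anti3 g v u, neg_neg]
    have c3' : (ιE g u * ιE g z) * (ιE g v * ιE g w) = (ιE g u * ιE g v) * (ιE g w * ιE g z) := by
      rw [comm2, c3]
    rw [c1, c2, c2', c3, c3', mul_assoc (ιE g u * ιE g v)]
    module)
  have hII := span4 g (cC g ∘ₗ LinearMap.mulLeft ℚ (θE g) ∘ₗ cC g)
    (((g : ℚ) - 2) • cC g + (Φ ∘ₗ cC g).smulRight (θE g)) (by
    intro u v w z
    simp only [LinearMap.add_apply,
      LinearMap.smul_apply, LinearMap.comp_apply, LinearMap.mulLeft_apply,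
      LinearMap.smulRight_apply, cC4, map_smul, map_add, map_sub, hΦ, smul_eq_mul,
      mul_add, mul_sub, mul_smul_comm, cCθ]
    module)
  have inj : ∀ x ∈ (⋀[ℚ]^4 (H g) : Submodule ℚ (ExteriorAlgebra ℚ (H g))), φhat x = 0 → x = 0 := by
    intro x hx h0
    have h1 := hI x hx
    have h2 := hII x hx
    simp only [LinearMap.add_apply, LinearMap.sub_apply,
      LinearMap.smul_apply, LinearMap.comp_apply, LinearMap.mulLeft_apply, LinearMap.id_apply,
      LinearMap.smulRight_apply, h0, map_zero] at h1 h2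
    have h3 := congrArg (cC g) h1
    simp only [map_zero, map_add, map_sub, map_smul, h2, cCθθ] at h3
    have h4 := congrArg Φ h3
    simp only [map_zero, map_add, map_sub, map_smul, Φθ g Φ hΦ, smul_eq_mul] at h4
    have hc : Φ (cC g x) = 0 := by
      have h5 : (4 * (g : ℚ) + 2) * Φ (cC g x) = 0 := by
        field_simp at h4
        linear_combination -h4
      rcases mul_eq_zero.1 h5 with h | h
      · exfalso
        have : (0 : ℚ) ≤ g := Nat.cast_nonneg g
        linarith
      · exact h
    have hC : cC g x = 0 := by
      rw [hc] at h3
      have h6 : (4 + 4 / (g : ℚ)) • cC g x = 0 := by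
        have e : (4 + 4 / (g : ℚ)) = 6 - 2 / (g : ℚ) * ((g : ℚ) - 2) := by
          field_simp
          ring
        rw [e, h3]
        module
      refine (smul_eq_zero.1 h6).resolve_left ?_
      positivity
    rw [hC] at h1
    simpa using h1.symm
  intro x hx y hy hxy
  exact sub_eq_zero.1 (inj _ (Submodule.sub_mem _ hx hy) (by rw [map_sub, hxy, sub_self]))
end
end

section
/- Let g ≥ 3. The subspace of Sp_{2g}(ℚ)-invariant vectors in ⋀²(Λ³₀H) is one-dimensional. (In the paper's notation: the trivial representation V(0) occurs with multiplicity exactly one in ⋀²V(λ₃) = 𝕃₂(Λ³₀H); this copy of V(0) is the unique quadratic relation appearing in the presentation of Gr^W_• 𝔲_g.) -/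
set_option synthInstance.maxHeartbeats 1000000
set_option maxHeartbeats 1000000
noncomputable section

/-- A linear map induces a map on each exterior power (functoriality). -/
lemma map_mem_exteriorPower {M : Type*} [AddCommGroup M] [Module ℚ M] (n : ℕ)
    (f : M →ₗ[ℚ] M) {x : ExteriorAlgebra ℚ M} (hx : x ∈ ⋀[ℚ]^n M) :
    ExteriorAlgebra.map f x ∈ ⋀[ℚ]^n M := by
  have hle : Submodule.map (ExteriorAlgebra.map f).toLinearMap
      (LinearMap.range (ExteriorAlgebra.ι ℚ (M := M)) ^ n) ≤
      LinearMap.range (ExteriorAlgebra.ι ℚ (M := M)) ^ n := by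
    rw [Submodule.map_pow]
    refine pow_le_pow_left' ?_ n
    rw [ExteriorAlgebra.ι_range_map_map]
    rintro y ⟨z, -, rfl⟩
    exact LinearMap.mem_range_self _ _
  exact hle (Submodule.mem_map_of_mem hx)

/-- The submodule `θ ∧ H` of `⋀³H`. -/
def Twedge (g : ℕ) : Submodule ℚ ↥(⋀[ℚ]^3 (H g)) :=
  Submodule.span ℚ
    {w : ↥(⋀[ℚ]^3 (H g)) | ∃ x : H g, (w : ExteriorAlgebra ℚ (H g)) = θE g * ιE g x}

/-- `Λ³₀H = ⋀³H / (θ ∧ H)`. -/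
abbrev Lambda30 (g : ℕ) := ↥(⋀[ℚ]^3 (H g)) ⧸ Twedge g

/-- The map on `⋀³H` functorially induced by (the multiplication by) a matrix `A`. -/
def act3 (g : ℕ) (A : Matrix (Fin g ⊕ Fin g) (Fin g ⊕ Fin g) ℚ) :
    ↥(⋀[ℚ]^3 (H g)) →ₗ[ℚ] ↥(⋀[ℚ]^3 (H g)) :=
  (ExteriorAlgebra.map (Matrix.mulVecLin A)).toLinearMap.restrict
    fun _ hx => map_mem_exteriorPower 3 (Matrix.mulVecLin A) hx

/-- The map on `⋀²(Λ³₀H)` functorially induced by a linear endomorphism of `Λ³₀H`. -/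
def act2 (g : ℕ) (fq : Lambda30 g →ₗ[ℚ] Lambda30 g) :
    ↥(⋀[ℚ]^2 (Lambda30 g)) →ₗ[ℚ] ↥(⋀[ℚ]^2 (Lambda30 g)) :=
  (ExteriorAlgebra.map fq).toLinearMap.restrict
    fun _ hx => map_mem_exteriorPower 2 fq hx

/-- The subspace of `Sp_{2g}(ℚ)`-invariant vectors of `⋀²(Λ³₀H)`: the vectors fixed by
the endomorphism of `⋀²(Λ³₀H)` induced by every symplectic matrix `A` (the action of
`A` on `Λ³₀H` being the descent to the quotient of the functorial action on `⋀³H`;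
this descent exists and is unique since `θ ∧ H` is `Sp`-stable). -/
def invariants (g : ℕ) : Submodule ℚ ↥(⋀[ℚ]^2 (Lambda30 g)) where
  carrier := {w | ∀ A ∈ Matrix.symplecticGroup (Fin g) ℚ,
    ∀ fq : Lambda30 g →ₗ[ℚ] Lambda30 g,
      (∀ v : ↥(⋀[ℚ]^3 (H g)),
        fq (Submodule.Quotient.mk v) = Submodule.Quotient.mk (act3 g A v)) →
      act2 g fq w = w}
  add_mem' := fun hx hy A hA fq hfq => by
    rw [map_add, hx A hA fq hfq, hy A hA fq hfq]
  zero_mem' := fun A hA fq hfq => by rw [map_zero]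
  smul_mem' := fun c x hx A hA fq hfq => by rw [map_smul, hx A hA fq hfq]

/-- Contraction by a functional on the exterior algebra. -/
def ctr {M : Type*} [AddCommGroup M] [Module ℚ M] (d : Module.Dual ℚ M) :
    ExteriorAlgebra ℚ M →ₗ[ℚ] ExteriorAlgebra ℚ M :=
  CliffordAlgebra.contractLeft (Q := (0 : QuadraticForm ℚ M)) d

section ctr
variable {M : Type*} [AddCommGroup M] [Module ℚ M]

lemma ctr_ι_mul (d : Module.Dual ℚ M) (x : M) (b : ExteriorAlgebra ℚ M) :
    ctr d (ExteriorAlgebra.ι ℚ x * b) = d x • b - ExteriorAlgebra.ι ℚ x * ctr d b :=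
  CliffordAlgebra.contractLeft_ι_mul _ _ _

lemma ctr_ι (d : Module.Dual ℚ M) (x : M) :
    ctr d (ExteriorAlgebra.ι ℚ x) = algebraMap ℚ _ (d x) :=
  CliffordAlgebra.contractLeft_ι _ _ _

lemma ctr_algebraMap (d : Module.Dual ℚ M) (r : ℚ) :
    ctr d (algebraMap ℚ (ExteriorAlgebra ℚ M) r) = 0 :=
  CliffordAlgebra.contractLeft_algebraMap _ _ _

lemma ctr_one_s6 (d : Module.Dual ℚ M) :
    ctr d (1 : ExteriorAlgebra ℚ M) = 0 :=
  CliffordAlgebra.contractLeft_one _ _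

lemma ctr_ctr (d : Module.Dual ℚ M) (x : ExteriorAlgebra ℚ M) :
    ctr d (ctr d x) = 0 :=
  CliffordAlgebra.contractLeft_contractLeft _ _

lemma ctr_comm (d d' : Module.Dual ℚ M) (x : ExteriorAlgebra ℚ M) :
    ctr d (ctr d' x) = - ctr d' (ctr d x) :=
  CliffordAlgebra.contractLeft_comm _ _ _

lemma ctr_add (d d' : Module.Dual ℚ M) (x : ExteriorAlgebra ℚ M) :
    ctr (d + d') x = ctr d x + ctr d' x := by
  simp [ctr]

lemma ctr_smul (c : ℚ) (d : Module.Dual ℚ M) (x : ExteriorAlgebra ℚ M) :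
    ctr (c • d) x = c • ctr d x := by
  simp [ctr]

lemma ctr_map (d : Module.Dual ℚ M) (f : M →ₗ[ℚ] M) (x : ExteriorAlgebra ℚ M) :
    ctr d (ExteriorAlgebra.map f x) = ExteriorAlgebra.map f (ctr (d ∘ₗ f) x) := by
  induction x using CliffordAlgebra.left_induction with
  | algebraMap r =>
    have h : ctr (d ∘ₗ f) (algebraMap ℚ (ExteriorAlgebra ℚ M) r) = 0 := ctr_algebraMap _ _
    erw [h, AlgHom.commutes, ctr_algebraMap, map_zero]
  | add x y hx hy => rw [map_add, map_add, hx, hy, map_add, map_add]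
  | ι_mul x m hx =>
    have h : ctr (d ∘ₗ f) (ExteriorAlgebra.ι ℚ m * x) = _ := ctr_ι_mul _ _ _
    erw [h, map_mul, ExteriorAlgebra.map_apply_ι, ctr_ι_mul, hx]
    rw [map_sub, map_mul, ExteriorAlgebra.map_apply_ι, map_smul]
    rfl

lemma ctr_mem (n : ℕ) (d : Module.Dual ℚ M) (x : ExteriorAlgebra ℚ M)
    (hx : x ∈ ⋀[ℚ]^(n+1) M) : ctr d x ∈ ⋀[ℚ]^n M := by
  induction n generalizing x with
  | zero =>
    simp only [zero_add, ExteriorAlgebra.exteriorPower, pow_one] at hx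
    obtain ⟨y, rfl⟩ := hx
    rw [ctr_ι]
    simp only [ExteriorAlgebra.exteriorPower, pow_zero]
    exact Submodule.algebraMap_mem _
  | succ n ih =>
    rw [ExteriorAlgebra.exteriorPower, pow_succ'] at hx
    induction hx using Submodule.mul_induction_on' with
    | mem_mul_mem a ha b hb =>
      obtain ⟨y, rfl⟩ := ha
      rw [ctr_ι_mul]
      refine Submodule.sub_mem _ (Submodule.smul_mem _ _ hb) ?_
      rw [ExteriorAlgebra.exteriorPower, pow_succ']
      exact Submodule.mul_mem_mul ⟨y, rfl⟩ (ih b hb)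
    | add a ha b hb h1 h2 => rw [map_add]; exact Submodule.add_mem _ h1 h2

/-- Euler's formula for contractions. -/
lemma euler {I : Type*} [Fintype I] (bs : Module.Basis I ℚ M) (n : ℕ) (x : ExteriorAlgebra ℚ M)
    (hx : x ∈ ⋀[ℚ]^n M) :
    ∑ i, ExteriorAlgebra.ι ℚ (bs i) * ctr (bs.coord i) x = (n : ℚ) • x := by
  induction n generalizing x with
  | zero =>
    simp only [ExteriorAlgebra.exteriorPower, pow_zero, Submodule.mem_one] at hx
    obtain ⟨y, rfl⟩ := hx
    simp [ctr_algebraMap]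
  | succ n ih =>
    rw [ExteriorAlgebra.exteriorPower, pow_succ'] at hx
    induction hx using Submodule.mul_induction_on' with
    | mem_mul_mem a ha b hb =>
      obtain ⟨y, rfl⟩ := ha
      simp only [ctr_ι_mul, mul_sub, Finset.sum_sub_distrib]
      have h1 : ∑ i, ExteriorAlgebra.ι ℚ (bs i) * (bs.coord i y • b)
          = ExteriorAlgebra.ι ℚ y * b := by
        conv_rhs => rw [← bs.sum_repr y, map_sum, Finset.sum_mul]
        simp
      have h2 : ∑ i, ExteriorAlgebra.ι ℚ (bs i) * (ExteriorAlgebra.ι ℚ y * ctr (bs.coord i) b)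
          = - (ExteriorAlgebra.ι ℚ y * ((n:ℚ) • b)) := by
        rw [← ih b hb, Finset.mul_sum, ← Finset.sum_neg_distrib]
        refine Finset.sum_congr rfl fun i _ => ?_
        rw [← mul_assoc, ← mul_assoc, ← neg_mul, eq_neg_of_add_eq_zero_left
          (ExteriorAlgebra.ι_add_mul_swap (bs i) y)]
      rw [h1, h2, sub_neg_eq_add]
      push_cast
      rw [add_smul, one_smul, mul_smul_comm, add_comm]
    | add a ha b hb h1 h2 =>
      simp only [map_add, mul_add, Finset.sum_add_distrib, h1, h2, smul_add]

/-- Scalar triple contraction. -/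
def TE (d₁ d₂ d₃ : Module.Dual ℚ M) : ExteriorAlgebra ℚ M →ₗ[ℚ] ℚ :=
  ExteriorAlgebra.algebraMapInv.toLinearMap ∘ₗ ctr d₃ ∘ₗ ctr d₂ ∘ₗ ctr d₁

lemma TE_def (d₁ d₂ d₃ : Module.Dual ℚ M) (x) : TE d₁ d₂ d₃ x =
    ExteriorAlgebra.algebraMapInv (ctr d₃ (ctr d₂ (ctr d₁ x))) := rfl

lemma TE_ι3 (d₁ d₂ d₃ : Module.Dual ℚ M) (x y z : M) : TE d₁ d₂ d₃
    (ExteriorAlgebra.ι ℚ x * ExteriorAlgebra.ι ℚ y * ExteriorAlgebra.ι ℚ z) =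
    d₁ x * (d₂ y * d₃ z - d₂ z * d₃ y) - d₁ y * (d₂ x * d₃ z - d₂ z * d₃ x)
    + d₁ z * (d₂ x * d₃ y - d₂ y * d₃ x) := by
  have key : ∀ (d : Module.Dual ℚ M) (x : M),
      ctr d (ExteriorAlgebra.ι ℚ x) = d x • (1 : ExteriorAlgebra ℚ M) := fun d x => by
    rw [ctr_ι, Algebra.algebraMap_eq_smul_one]
  rw [TE_def, mul_assoc]
  simp only [ctr_ι_mul, key, ctr_one_s6, map_sub, map_smul, map_zero, mul_zero, mul_one, sub_zero,
    mul_smul_comm, smul_zero, mul_sub, smul_sub, map_one, smul_eq_mul]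
  ring

lemma TE_map (d₁ d₂ d₃ : Module.Dual ℚ M) (f : M →ₗ[ℚ] M) (x : ExteriorAlgebra ℚ M) :
    TE d₁ d₂ d₃ (ExteriorAlgebra.map f x) = TE (d₁ ∘ₗ f) (d₂ ∘ₗ f) (d₃ ∘ₗ f) x := by
  rw [TE_def, TE_def, ctr_map, ctr_map, ctr_map]
  have : (ExteriorAlgebra.algebraMapInv (R := ℚ) (M := M)).comp (ExteriorAlgebra.map f)
    = ExteriorAlgebra.algebraMapInv := by
    ext y; simp [ExteriorAlgebra.algebraMapInv]
  exact DFunLike.congr_fun this _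

lemma TE_swap12 (d₁ d₂ d₃ : Module.Dual ℚ M) (x) : TE d₂ d₁ d₃ x = - TE d₁ d₂ d₃ x := by
  rw [TE_def, TE_def, ctr_comm d₁ d₂]; simp

lemma TE_swap23 (d₁ d₂ d₃ : Module.Dual ℚ M) (x) : TE d₁ d₃ d₂ x = - TE d₁ d₂ d₃ x := by
  rw [TE_def, TE_def, ctr_comm d₂ d₃]; simp

lemma TE_self23 (d₁ d₂ : Module.Dual ℚ M) (x) : TE d₁ d₂ d₂ x = 0 := by
  rw [TE_def, ctr_ctr]; simp

lemma TE_recover (d₁ d₂ d₃ : Module.Dual ℚ M) (x : ExteriorAlgebra ℚ M) (hx : x ∈ ⋀[ℚ]^3 M) :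
    ctr d₃ (ctr d₂ (ctr d₁ x)) = algebraMap ℚ _ (TE d₁ d₂ d₃ x) := by
  have h := ctr_mem 0 d₃ _ (ctr_mem 1 d₂ _ (ctr_mem 2 d₁ _ hx))
  simp only [ExteriorAlgebra.exteriorPower, pow_zero, Submodule.mem_one] at h
  obtain ⟨y, hy⟩ := h
  rw [TE_def, ← hy]
  congr 1
  exact (ExteriorAlgebra.algebraMap_leftInverse M y).symm

lemma eq_zero_of_ctr {I : Type*} [Fintype I] (bs : Module.Basis I ℚ M) (n : ℕ)
    (x : ExteriorAlgebra ℚ M) (hx : x ∈ ⋀[ℚ]^(n+1) M) (h : ∀ i, ctr (bs.coord i) x = 0) :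
    x = 0 := by
  have := euler bs _ x hx
  simp only [h, mul_zero, Finset.sum_const_zero] at this
  have h2 : ((n + 1 : ℕ) : ℚ) ≠ 0 := by positivity
  exact (smul_eq_zero.mp this.symm).resolve_left h2

lemma eq_zero_of_TE {I : Type*} [Fintype I] (bs : Module.Basis I ℚ M)
    (x : ExteriorAlgebra ℚ M) (hx : x ∈ ⋀[ℚ]^3 M)
    (h : ∀ i j k, TE (bs.coord i) (bs.coord j) (bs.coord k) x = 0) :
    x = 0 := by
  refine eq_zero_of_ctr bs 2 x hx fun i => ?_
  refine eq_zero_of_ctr bs 1 _ (ctr_mem _ _ _ hx) fun j => ?_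
  refine eq_zero_of_ctr bs 0 _ (ctr_mem _ _ _ (ctr_mem _ _ _ hx)) fun k => ?_
  rw [TE_recover _ _ _ _ hx, h, map_zero]

end ctr

section partB

lemma twedge_mem_ext (g : ℕ) (x : H g) : θE g * ιE g x ∈ ⋀[ℚ]^3 (H g) := by
  rw [θE, Finset.sum_mul]
  refine Submodule.sum_mem _ fun i _ => ?_
  have h : ∀ y : H g, ιE g y ∈ LinearMap.range (ExteriorAlgebra.ι ℚ (M := H g)) := fun y => ⟨y, rfl⟩
  rw [ExteriorAlgebra.exteriorPower, pow_succ, pow_two]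
  exact Submodule.mul_mem_mul (Submodule.mul_mem_mul (h _) (h _)) (h _)

/-- The induced pairing on functionals. -/
def PP (g : ℕ) (d d' : Module.Dual ℚ (H g)) : ℚ :=
  ∑ i : Fin g, (d (aa g i) * d' (bb g i) - d (bb g i) * d' (aa g i))

lemma TE_θ (g : ℕ) (d₁ d₂ d₃ : Module.Dual ℚ (H g)) (x : H g) :
    TE d₁ d₂ d₃ (θE g * ιE g x) = PP g d₁ d₂ * d₃ x + PP g d₂ d₃ * d₁ x - PP g d₁ d₃ * d₂ x := by
  rw [θE, Finset.sum_mul, map_sum]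
  simp only [TE_ι3, PP, Finset.sum_mul, ← Finset.sum_add_distrib, ← Finset.sum_sub_distrib]
  refine Finset.sum_congr rfl fun i _ => ?_
  ring

/-- Coordinate functionals. -/
abbrev pr (g : ℕ) (p : Fin g ⊕ Fin g) : Module.Dual ℚ (H g) := LinearMap.proj p

lemma coord_eq (g : ℕ) (p : Fin g ⊕ Fin g) : (Pi.basisFun ℚ (Fin g ⊕ Fin g)).coord p = pr g p := by
  ext; simp

lemma PP_pr_ll (g : ℕ) (i j : Fin g) : PP g (pr g (Sum.inl i)) (pr g (Sum.inl j)) = 0 := by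
  simp [PP, aa, bb]
lemma PP_pr_rr (g : ℕ) (i j : Fin g) : PP g (pr g (Sum.inr i)) (pr g (Sum.inr j)) = 0 := by
  simp [PP, aa, bb]
lemma PP_pr_lr (g : ℕ) (i j : Fin g) : PP g (pr g (Sum.inl i)) (pr g (Sum.inr j)) =
    if i = j then 1 else 0 := by
  simp [PP, aa, bb, Pi.single_apply]
lemma PP_pr_rl (g : ℕ) (i j : Fin g) : PP g (pr g (Sum.inr i)) (pr g (Sum.inl j)) =
    if i = j then -1 else 0 := by
  simp [PP, aa, bb, Pi.single_apply]; split_ifs <;> rfl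

/-- The underlying index. -/
def idx {g : ℕ} (p : Fin g ⊕ Fin g) : Fin g := Sum.elim id id p

lemma PP_pr_ne (g : ℕ) (p q : Fin g ⊕ Fin g) (h : idx p ≠ idx q) : PP g (pr g p) (pr g q) = 0 := by
  rcases p with i | i <;> rcases q with j | j <;>
    simp_all [PP_pr_ll, PP_pr_rr, PP_pr_lr, PP_pr_rl, idx]

lemma mem_Twedge_of (g : ℕ) (hg : 3 ≤ g) (u : ↥(⋀[ℚ]^3 (H g)))
    (h1 : ∀ p q r : Fin g ⊕ Fin g, idx p ≠ idx q → idx p ≠ idx r → idx q ≠ idx r →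
      TE (pr g p) (pr g q) (pr g r) u = 0)
    (h2 : ∀ (p : Fin g ⊕ Fin g) (i j : Fin g), idx p ≠ i → idx p ≠ j →
      TE (pr g p) (pr g (Sum.inl i)) (pr g (Sum.inr i)) u =
      TE (pr g p) (pr g (Sum.inl j)) (pr g (Sum.inr j)) u) : u ∈ Twedge g := by
  have hn : ∀ i : Fin g, ∃ j : Fin g, i ≠ j := fun i => by
    by_cases h : i = ⟨0, by omega⟩
    · exact ⟨⟨1, by omega⟩, by subst h; simp⟩
    · exact ⟨_, h⟩
  choose ν hν using hn
  let c : Fin g ⊕ Fin g → ℚ := fun p =>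
    TE (pr g p) (pr g (Sum.inl (ν (idx p)))) (pr g (Sum.inr (ν (idx p)))) u
  let y : H g := c
  let t : ↥(⋀[ℚ]^3 (H g)) := ⟨θE g * ιE g y, twedge_mem_ext g y⟩
  have ht : t ∈ Twedge g := Submodule.subset_span ⟨y, rfl⟩
  have hpy : ∀ p, (pr g p) y = c p := fun p => rfl
  set x : ExteriorAlgebra ℚ (H g) := u - t with hx
  have hT : ∀ p q r, TE (pr g p) (pr g q) (pr g r) x = TE (pr g p) (pr g q) (pr g r) u -
      (PP g (pr g p) (pr g q) * c r + PP g (pr g q) (pr g r) * c p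
        - PP g (pr g p) (pr g r) * c q) := by
    intro p q r
    rw [hx, map_sub]
    congr 1
    exact TE_θ g _ _ _ _
  have k1 : ∀ p i, idx p ≠ i → TE (pr g p) (pr g (Sum.inl i)) (pr g (Sum.inr i)) x = 0 := by
    intro p i hp
    rw [hT, h2 p i (ν (idx p)) hp (hν _), PP_pr_ne g p (Sum.inl i) hp, PP_pr_ne g p (Sum.inr i) hp,
      PP_pr_lr]
    simp [c]
  have k2 : ∀ p q r, idx q = idx r → TE (pr g p) (pr g q) (pr g r) x = 0 := by
    intro p q r hqr
    by_cases hpq : p = q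
    · subst hpq
      rw [TE_swap23, TE_swap12, TE_self23]; simp
    by_cases hpr : p = r
    · subst hpr
      rw [TE_swap12, TE_self23]; simp
    rcases q with i | i <;> rcases r with j | j <;> simp only [idx, Sum.elim_inl, Sum.elim_inr, id] at hqr <;> subst hqr
    · exact TE_self23 _ _ _
    · apply k1
      rcases p with k | k <;> simp_all [idx]
    · rw [TE_swap23, k1, neg_zero]
      rcases p with k | k <;> simp_all [idx]
    · exact TE_self23 _ _ _
  have k3 : ∀ p q r, TE (pr g p) (pr g q) (pr g r) x = 0 := by
    intro p q r
    by_cases a1 : idx q = idx r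
    · exact k2 p q r a1
    by_cases a2 : idx p = idx r
    · rw [TE_swap12, k2 _ _ _ a2, neg_zero]
    by_cases a3 : idx p = idx q
    · rw [TE_swap23, TE_swap12, k2 _ _ _ a3]; simp
    rw [hT, h1 p q r a3 a2 a1, PP_pr_ne _ _ _ a1, PP_pr_ne _ _ _ a2, PP_pr_ne _ _ _ a3]
    ring
  have hx0 : x = 0 := by
    refine eq_zero_of_TE (Pi.basisFun ℚ (Fin g ⊕ Fin g)) x (Submodule.sub_mem _ u.2 t.2) ?_
    intro i j k
    rw [coord_eq, coord_eq, coord_eq, k3]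
  have : u = t := Subtype.ext (sub_eq_zero.mp hx0)
  rw [this]; exact ht

lemma bilin_inv (g : ℕ) {N : Type*} [AddCommGroup N] [Module ℚ N] (B : H g →ₗ[ℚ] H g →ₗ[ℚ] N)
    (A : Matrix (Fin g ⊕ Fin g) (Fin g ⊕ Fin g) ℚ) (hA : A ∈ Matrix.symplecticGroup (Fin g) ℚ) :
    ∑ i : Fin g, (B (A.mulVec (aa g i)) (A.mulVec (bb g i))
      - B (A.mulVec (bb g i)) (A.mulVec (aa g i))) =
    ∑ i : Fin g, (B (aa g i) (bb g i) - B (bb g i) (aa g i)) := by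
  have hcol : ∀ p, A.mulVec (Pi.single p 1) = ∑ s, A s p • (Pi.single s 1 : H g) := by
    intro p
    ext t
    simp [Pi.single_apply]
  have hJ : ∀ s t, ∑ i : Fin g, (A s (Sum.inl i) * A t (Sum.inr i)
      - A s (Sum.inr i) * A t (Sum.inl i)) = - Matrix.J (Fin g) ℚ s t := by
    intro s t
    rw [← SymplecticGroup.mem_iff.mp hA]
    simp [Matrix.mul_apply, Matrix.J, Fintype.sum_sum_type, Matrix.one_apply,
      Finset.sum_sub_distrib]
    ring
  have gen : ∑ i : Fin g, (B (A.mulVec (aa g i)) (A.mulVec (bb g i))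
      - B (A.mulVec (bb g i)) (A.mulVec (aa g i))) = ∑ s, ∑ t, (- Matrix.J (Fin g) ℚ s t) •
        B (Pi.single s 1) (Pi.single t 1) := by
    have hB : ∀ p q, B (A.mulVec (Pi.single p 1)) (A.mulVec (Pi.single q 1)) =
        ∑ s, ∑ t, (A s p * A t q) • B (Pi.single s 1) (Pi.single t 1) := by
      intro p q
      rw [hcol, hcol]
      simp only [map_sum, LinearMap.sum_apply, map_smul, LinearMap.smul_apply, Finset.smul_sum,
        mul_smul]
      rw [Finset.sum_comm]
      refine Finset.sum_congr rfl fun s _ => Finset.sum_congr rfl fun t _ => ?_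
      rw [smul_comm]
    simp only [aa, bb, hB, ← Finset.sum_sub_distrib, ← sub_smul]
    rw [Finset.sum_comm]
    refine Finset.sum_congr rfl fun s _ => ?_
    rw [Finset.sum_comm]
    refine Finset.sum_congr rfl fun t _ => ?_
    rw [← hJ, Finset.sum_smul]
  rw [gen]
  simp [Matrix.J, Fintype.sum_sum_type, Matrix.one_apply, aa, bb, Finset.sum_add_distrib, sub_eq_add_neg]
  
end partB

section partC
variable {g : ℕ}

lemma map_θ (A : Matrix (Fin g ⊕ Fin g) (Fin g ⊕ Fin g) ℚ)
    (hA : A ∈ Matrix.symplecticGroup (Fin g) ℚ) :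
    ExteriorAlgebra.map (Matrix.mulVecLin A) (θE g) = θE g := by
  have h := bilin_inv g ((LinearMap.mul ℚ (ExteriorAlgebra ℚ (H g))).compl₁₂ (ιE g) (ιE g)) A hA
  have sw : ∀ x y : H g, ιE g x * ιE g y - ιE g y * ιE g x = (2 : ℚ) • (ιE g x * ιE g y) := by
    intro x y
    rw [eq_neg_of_add_eq_zero_right (ExteriorAlgebra.ι_add_mul_swap (R := ℚ) x y), two_smul]
    abel
  simp only [LinearMap.compl₁₂_apply, LinearMap.mul_apply', sw, ← Finset.smul_sum] at h
  have h2 := smul_right_injective _ (two_ne_zero (α := ℚ)) h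
  rw [θE, map_sum]
  simpa only [map_mul, ExteriorAlgebra.map_apply_ι, Matrix.mulVecLin_apply] using h2

lemma act3_coe (A : Matrix (Fin g ⊕ Fin g) (Fin g ⊕ Fin g) ℚ) (v : ↥(⋀[ℚ]^3 (H g))) :
    (act3 g A v : ExteriorAlgebra ℚ (H g)) = ExteriorAlgebra.map (Matrix.mulVecLin A) v := rfl

lemma act3_stable (A : Matrix (Fin g ⊕ Fin g) (Fin g ⊕ Fin g) ℚ)
    (hA : A ∈ Matrix.symplecticGroup (Fin g) ℚ) :
    Twedge g ≤ (Twedge g).comap (act3 g A) := by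
  conv_lhs => rw [Twedge]
  rw [Submodule.span_le]
  rintro w ⟨x, hx⟩
  refine Submodule.subset_span ⟨A.mulVec x, ?_⟩
  rw [act3_coe, hx, map_mul, map_θ A hA, ExteriorAlgebra.map_apply_ι, Matrix.mulVecLin_apply]

/-- The action on the quotient. -/
def qact (A : Matrix (Fin g ⊕ Fin g) (Fin g ⊕ Fin g) ℚ)
    (hA : A ∈ Matrix.symplecticGroup (Fin g) ℚ) : Lambda30 g →ₗ[ℚ] Lambda30 g :=
  (Twedge g).mapQ (Twedge g) (act3 g A) (act3_stable A hA)

lemma qact_mk (A : Matrix (Fin g ⊕ Fin g) (Fin g ⊕ Fin g) ℚ)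
    (hA : A ∈ Matrix.symplecticGroup (Fin g) ℚ) (v : ↥(⋀[ℚ]^3 (H g))) :
    qact A hA (Submodule.Quotient.mk v) = Submodule.Quotient.mk (act3 g A v) := rfl

lemma act3_mul (A B : Matrix (Fin g ⊕ Fin g) (Fin g ⊕ Fin g) ℚ) (v : ↥(⋀[ℚ]^3 (H g))) :
    act3 g A (act3 g B v) = act3 g (A * B) v := by
  apply Subtype.ext
  rw [act3_coe, act3_coe, act3_coe, Matrix.mulVecLin_mul, ← ExteriorAlgebra.map_comp_map]
  rfl

lemma act3_one (v : ↥(⋀[ℚ]^3 (H g))) : act3 g 1 v = v := by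
  apply Subtype.ext
  rw [act3_coe, Matrix.mulVecLin_one, ExteriorAlgebra.map_id]
  rfl

/-- Triple contraction on the third exterior power. -/
def T3 (d₁ d₂ d₃ : Module.Dual ℚ (H g)) : Module.Dual ℚ ↥(⋀[ℚ]^3 (H g)) :=
  TE d₁ d₂ d₃ ∘ₗ Submodule.subtype _

lemma T3_apply (d₁ d₂ d₃ : Module.Dual ℚ (H g)) (u : ↥(⋀[ℚ]^3 (H g))) :
  T3 d₁ d₂ d₃ u = TE d₁ d₂ d₃ (u : ExteriorAlgebra ℚ (H g)) := rfl

lemma T3_act (d₁ d₂ d₃ : Module.Dual ℚ (H g)) (A : Matrix (Fin g ⊕ Fin g) (Fin g ⊕ Fin g) ℚ)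
    (u : ↥(⋀[ℚ]^3 (H g))) :
    T3 d₁ d₂ d₃ (act3 g A u) = T3 (d₁ ∘ₗ A.mulVecLin) (d₂ ∘ₗ A.mulVecLin) (d₃ ∘ₗ A.mulVecLin) u := by
  rw [T3_apply, act3_coe, TE_map]; rfl

lemma le_ker (T : Module.Dual ℚ ↥(⋀[ℚ]^3 (H g)))
    (h : ∀ x, T ⟨θE g * ιE g x, twedge_mem_ext g x⟩ = 0) : ∀ t ∈ Twedge g, T t = 0 := by
  have : Twedge g ≤ LinearMap.ker T := by
    rw [Twedge, Submodule.span_le]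
    rintro w ⟨x, hx⟩
    have : w = ⟨θE g * ιE g x, twedge_mem_ext g x⟩ := Subtype.ext hx
    rw [this]; exact h x
  exact this

lemma T3_iso (p q r : Fin g ⊕ Fin g) (h1 : idx p ≠ idx q) (h2 : idx p ≠ idx r)
    (h3 : idx q ≠ idx r) : ∀ t ∈ Twedge g, T3 (pr g p) (pr g q) (pr g r) t = 0 := by
  apply le_ker
  intro x
  rw [T3_apply, TE_θ, PP_pr_ne _ _ _ h1, PP_pr_ne _ _ _ h2, PP_pr_ne _ _ _ h3]
  ring

/-- The second type of functional. -/
def T4 (p : Fin g ⊕ Fin g) (i j : Fin g) : Module.Dual ℚ ↥(⋀[ℚ]^3 (H g)) :=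
  T3 (pr g p) (pr g (Sum.inl i)) (pr g (Sum.inr i)) -
  T3 (pr g p) (pr g (Sum.inl j)) (pr g (Sum.inr j))

lemma T4_iso (p : Fin g ⊕ Fin g) (i j : Fin g) (h1 : idx p ≠ i) (h2 : idx p ≠ j) :
    ∀ t ∈ Twedge g, T4 p i j t = 0 := by
  apply le_ker
  intro x
  rw [T4, LinearMap.sub_apply, T3_apply, TE_θ, T3_apply, TE_θ, 
    PP_pr_ne _ p (Sum.inl i) h1, PP_pr_ne _ p (Sum.inr i) h1,
    PP_pr_ne _ p (Sum.inl j) h2, PP_pr_ne _ p (Sum.inr j) h2, PP_pr_lr, PP_pr_lr]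
  simp

lemma TE_smul {M : Type*} [AddCommGroup M] [Module ℚ M] (a b c : ℚ) (d₁ d₂ d₃ : Module.Dual ℚ M)
    (x : ExteriorAlgebra ℚ M) :
    TE (a • d₁) (b • d₂) (c • d₃) x = (a * b * c) * TE d₁ d₂ d₃ x := by
  simp only [TE_def, ctr_smul, map_smul, smul_eq_mul]; ring

lemma TE_add2 {M : Type*} [AddCommGroup M] [Module ℚ M] (d₁ d₂ d₂' d₃ : Module.Dual ℚ M)
    (x : ExteriorAlgebra ℚ M) :
    TE d₁ (d₂ + d₂') d₃ x = TE d₁ d₂ d₃ x + TE d₁ d₂' d₃ x := by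
  simp only [TE_def, ctr_add, map_add]

lemma TE_add3 {M : Type*} [AddCommGroup M] [Module ℚ M] (d₁ d₂ d₃ d₃' : Module.Dual ℚ M)
    (x : ExteriorAlgebra ℚ M) :
    TE d₁ d₂ (d₃ + d₃') x = TE d₁ d₂ d₃ x + TE d₁ d₂ d₃' x := by
  simp only [TE_def, ctr_add, map_add]

/-- Torus weights. -/
def wt (l : Fin g) (p : Fin g ⊕ Fin g) : ℚ :=
  Sum.elim (fun i => if i = l then 2 else 1) (fun i => if i = l then 1/2 else 1) p

lemma torus_mem (l : Fin g) : Matrix.diagonal (wt l) ∈ Matrix.symplecticGroup (Fin g) ℚ := by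
  rw [SymplecticGroup.mem_iff, Matrix.diagonal_transpose]
  ext p q
  rw [Matrix.mul_diagonal, Matrix.diagonal_mul]
  rcases p with i | i <;> rcases q with j | j <;>
    simp only [wt, Matrix.J, Matrix.fromBlocks_apply₁₁, Matrix.fromBlocks_apply₁₂, Matrix.zero_apply,
      Matrix.fromBlocks_apply₂₁, Matrix.fromBlocks_apply₂₂, Matrix.neg_apply, Matrix.one_apply,
      Sum.elim_inl, Sum.elim_inr] <;> split_ifs <;> simp_all

lemma torus_pr (l : Fin g) (p : Fin g ⊕ Fin g) :
    pr g p ∘ₗ (Matrix.diagonal (wt l)).mulVecLin = wt l p • pr g p := by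
  apply LinearMap.ext
  intro x
  simp [Matrix.mulVec_diagonal]

lemma perm_mem (σ : Equiv.Perm (Fin g)) :
    Matrix.fromBlocks (σ.permMatrix ℚ) 0 0 (σ.permMatrix ℚ) ∈ Matrix.symplecticGroup (Fin g) ℚ := by
  rw [SymplecticGroup.fromBlocks_mem_iff]
  simp only [Matrix.transpose_permMatrix, Matrix.transpose_zero, Matrix.mul_zero, Matrix.zero_mul,
    sub_zero, true_and, ← Matrix.permMatrix_mul]
  simp

lemma perm_pr (σ : Equiv.Perm (Fin g)) (i : Fin g) :
    pr g (Sum.inl i) ∘ₗ (Matrix.fromBlocks (σ.permMatrix ℚ) 0 0 (σ.permMatrix ℚ)).mulVecLin =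
    pr g (Sum.inl (σ i)) := by
  apply LinearMap.ext
  intro x
  simp [Matrix.fromBlocks_mulVec, Matrix.permMatrix_mulVec]

/-- Indicator. -/
def ind (S : Set (Fin g)) (i : Fin g) : ℚ := by
  classical exact if i ∈ S then 1 else 0

lemma ind_mul (S : Set (Fin g)) (i : Fin g) : ind S i * ind S i = ind S i := by
  unfold ind; split_ifs <;> simp

/-- Flip matrix. -/
def flipM (S : Set (Fin g)) : Matrix (Fin g ⊕ Fin g) (Fin g ⊕ Fin g) ℚ :=
  Matrix.fromBlocks (Matrix.diagonal (1 - ind S)) (Matrix.diagonal (ind S))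
    (Matrix.diagonal (- ind S)) (Matrix.diagonal (1 - ind S))

lemma flip_mem (S : Set (Fin g)) : flipM S ∈ Matrix.symplecticGroup (Fin g) ℚ := by
  rw [flipM, SymplecticGroup.fromBlocks_mem_iff]
  simp only [Matrix.diagonal_transpose, Matrix.diagonal_mul_diagonal]
  refine ⟨?_, ?_, ?_⟩
  · congr 1; ext i; simp; ring
  · congr 1; ext i; simp; ring
  · rw [Matrix.diagonal_sub, ← Matrix.diagonal_one]
    congr 1; ext i
    have := ind_mul S i
    simp; linarith

lemma flip_pr (S : Set (Fin g)) (p : Fin g ⊕ Fin g) (hp : idx p ∈ S ↔ p = Sum.inr (idx p)) :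
    pr g (Sum.inl (idx p)) ∘ₗ (flipM S).mulVecLin = pr g p := by
  apply LinearMap.ext
  intro x
  rcases p with i | i <;>
  simp_all [flipM, Matrix.fromBlocks_mulVec, Matrix.mulVec_diagonal, idx, ind]

/-- Shear matrix. -/
def shearM (i j : Fin g) : Matrix (Fin g ⊕ Fin g) (Fin g ⊕ Fin g) ℚ :=
  Matrix.fromBlocks 1 (Matrix.single i j 1 + Matrix.single j i 1) 0 1

lemma shear_mem (i j : Fin g) : shearM i j ∈ Matrix.symplecticGroup (Fin g) ℚ := by
  rw [shearM, SymplecticGroup.fromBlocks_mem_iff]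
  simp [add_comm]

lemma shear_pr (i j : Fin g) (p : Fin g ⊕ Fin g) (h1 : idx p ≠ i) (h2 : idx p ≠ j) :
    pr g p ∘ₗ (shearM i j).mulVecLin = pr g p := by
  apply LinearMap.ext
  intro x
  rcases p with k | k <;>
  simp_all [shearM, Matrix.fromBlocks_mulVec, idx, Matrix.add_mulVec, Matrix.single_mulVec]

lemma shear_pr_i (i j : Fin g) (h : i ≠ j) :
    pr g (Sum.inl i) ∘ₗ (shearM i j).mulVecLin = pr g (Sum.inl i) + pr g (Sum.inr j) := by
  apply LinearMap.ext
  intro x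
  simp_all [shearM, Matrix.fromBlocks_mulVec, idx, Matrix.add_mulVec, Matrix.single_mulVec]

lemma shear_pr_j (i j : Fin g) (h : i ≠ j) :
    pr g (Sum.inl j) ∘ₗ (shearM i j).mulVecLin = pr g (Sum.inl j) + pr g (Sum.inr i) := by
  apply LinearMap.ext
  intro x
  simp_all [shearM, Matrix.fromBlocks_mulVec, idx, Matrix.add_mulVec, Matrix.single_mulVec, h.symm]

end partC

section partD
variable {g : ℕ}

/-- The functional descends to one whose contraction with `x` is zero. -/
def InK (x : ExteriorAlgebra ℚ (Lambda30 g)) (T : Module.Dual ℚ ↥(⋀[ℚ]^3 (H g))) : Prop :=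
  ∃ f : Module.Dual ℚ (Lambda30 g), ctr f x = 0 ∧ ∀ u, f (Submodule.Quotient.mk u) = T u

lemma InK.sub {x : ExteriorAlgebra ℚ (Lambda30 g)} {T T' : Module.Dual ℚ ↥(⋀[ℚ]^3 (H g))}
    (h : InK x T) (h' : InK x T') : InK x (T - T') := by
  obtain ⟨f, hf, hf'⟩ := h
  obtain ⟨k, hk, hk'⟩ := h'
  refine ⟨f + (-1 : ℚ) • k, ?_, fun u => ?_⟩
  · rw [ctr_add, ctr_smul, hf, hk]; simp
  · simp [hf', hk', sub_eq_add_neg]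

lemma InK.act {x : ExteriorAlgebra ℚ (Lambda30 g)} {T T' : Module.Dual ℚ ↥(⋀[ℚ]^3 (H g))}
    (hx : ∀ A, ∀ hA : A ∈ Matrix.symplecticGroup (Fin g) ℚ, ExteriorAlgebra.map (qact A hA) x = x)
    (h : InK x T) (A) (hA : A ∈ Matrix.symplecticGroup (Fin g) ℚ)
    (hT : ∀ u, T' u = T (act3 g A u)) : InK x T' := by
  obtain ⟨f, hf, hf'⟩ := h
  refine ⟨f ∘ₗ qact A hA, ?_, fun u => ?_⟩
  · obtain ⟨A', hA', hAA⟩ : ∃ A' ∈ Matrix.symplecticGroup (Fin g) ℚ, A * A' = 1 := by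
      refine ⟨_, ((⟨A, hA⟩ : Matrix.symplecticGroup (Fin g) ℚ)⁻¹).2, ?_⟩
      exact congrArg Subtype.val (mul_inv_cancel (⟨A, hA⟩ : Matrix.symplecticGroup (Fin g) ℚ))
    have hc : (f ∘ₗ qact A hA) ∘ₗ qact A' hA' = f := by
      apply LinearMap.ext
      intro v
      obtain ⟨u, rfl⟩ := Submodule.Quotient.mk_surjective _ v
      rw [LinearMap.comp_apply, LinearMap.comp_apply, qact_mk, qact_mk, act3_mul, hAA, act3_one]
    conv_lhs => rw [← hx A' hA']
    rw [ctr_map, hc, hf, map_zero]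
  · rw [LinearMap.comp_apply, qact_mk, hf', hT]

lemma exists_perm (a b c i j k : Fin g) (h1 : a ≠ b) (h2 : a ≠ c) (h3 : b ≠ c)
    (k1 : i ≠ j) (k2 : i ≠ k) (k3 : j ≠ k) :
    ∃ σ : Equiv.Perm (Fin g), σ a = i ∧ σ b = j ∧ σ c = k := by
  let e1 : Fin 3 ↪ Fin g := ⟨![a, b, c], by
    intro s t; fin_cases s <;> fin_cases t <;> simp [h1, h2, h3, h1.symm, h2.symm, h3.symm]⟩
  let e2 : Fin 3 ↪ Fin g := ⟨![i, j, k], by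
    intro s t; fin_cases s <;> fin_cases t <;> simp [k1, k2, k3, k1.symm, k2.symm, k3.symm]⟩
  have : MulAction.IsMultiplyPretransitive (Equiv.Perm (Fin g)) (Fin g) 3 :=
    Equiv.Perm.isMultiplyPretransitive (Fin g) 3
  obtain ⟨σ, hσ⟩ := MulAction.exists_smul_eq (Equiv.Perm (Fin g)) e1 e2
  refine ⟨σ, ?_, ?_, ?_⟩
  · exact DFunLike.congr_fun hσ 0
  · exact DFunLike.congr_fun hσ 1
  · exact DFunLike.congr_fun hσ 2

lemma eq_zero_of_InK (hg : 3 ≤ g) (x : ExteriorAlgebra ℚ (Lambda30 g))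
    (hx2 : x ∈ ⋀[ℚ]^2 (Lambda30 g))
    (hx : ∀ A, ∀ hA : A ∈ Matrix.symplecticGroup (Fin g) ℚ, ExteriorAlgebra.map (qact A hA) x = x)
    (i0 i1 i2 : Fin g) (h01 : i0 ≠ i1) (h02 : i0 ≠ i2) (h12 : i1 ≠ i2)
    (h : InK x (T3 (pr g (Sum.inl i0)) (pr g (Sum.inl i1)) (pr g (Sum.inl i2)))) : x = 0 := by
  have s1 : ∀ i j k : Fin g, i ≠ j → i ≠ k → j ≠ k →
      InK x (T3 (pr g (Sum.inl i)) (pr g (Sum.inl j)) (pr g (Sum.inl k))) := by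
    intro i j k hij hik hjk
    obtain ⟨σ, rfl, rfl, rfl⟩ := exists_perm i0 i1 i2 i j k h01 h02 h12 hij hik hjk
    refine h.act hx _ (perm_mem σ) fun u => ?_
    rw [T3_act, perm_pr, perm_pr, perm_pr]
  have s2 : ∀ p q r : Fin g ⊕ Fin g, idx p ≠ idx q → idx p ≠ idx r → idx q ≠ idx r →
      InK x (T3 (pr g p) (pr g q) (pr g r)) := by
    intro p q r hpq hpr hqr
    let S : Set (Fin g) := {i | p = Sum.inr i ∨ q = Sum.inr i ∨ r = Sum.inr i}
    refine (s1 _ _ _ hpq hpr hqr).act hx _ (flip_mem S) fun u => ?_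
    rw [T3_act, flip_pr, flip_pr, flip_pr]
    all_goals
      clear s1 hx h
      have := hpq.symm
      have := hpr.symm
      have := hqr.symm
      rcases p with i | i <;> rcases q with j | j <;> rcases r with k | k <;> simp_all [S, idx]
  have s3 : ∀ (p : Fin g ⊕ Fin g) (i j : Fin g), idx p ≠ i → idx p ≠ j → InK x (T4 p i j) := by
    intro p i j hi hj
    by_cases hij : i = j
    · subst hij
      refine ⟨0, by simp [ctr], fun u => by simp [T4]⟩
    have a1 : InK x (T3 (pr g p) (pr g (Sum.inl i) + pr g (Sum.inr j))
        (pr g (Sum.inl j) + pr g (Sum.inr i))) := by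
      refine (s2 p (Sum.inl i) (Sum.inl j) hi hj hij).act hx _ (shear_mem i j) fun u => ?_
      rw [T3_act, shear_pr i j p hi hj, shear_pr_i _ _ hij, shear_pr_j _ _ hij]
    have a2 := (a1.sub (s2 p (Sum.inl i) (Sum.inl j) hi hj hij)).sub
      (s2 p (Sum.inr j) (Sum.inr i) hj hi (Ne.symm hij))
    convert a2 using 1
    apply LinearMap.ext
    intro u
    simp only [T4, LinearMap.sub_apply, T3_apply, TE_add2, TE_add3]
    rw [TE_swap23 (pr g p) (pr g (Sum.inl j)) (pr g (Sum.inr j))]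
    ring
  let K : Submodule ℚ (Module.Dual ℚ (Lambda30 g)) :=
    { carrier := {f | ctr f x = 0}
      add_mem' := fun {a b} ha hb => by
        change ctr (a + b) x = 0
        rw [ctr_add, ha, hb, add_zero]
      zero_mem' := by simp [ctr]
      smul_mem' := fun c a ha => by
        change ctr (c • a) x = 0
        rw [ctr_smul, ha, smul_zero] }
  have hK0 : K.dualCoannihilator = ⊥ := by
    rw [eq_bot_iff]
    intro v hv
    obtain ⟨u, rfl⟩ := Submodule.Quotient.mk_surjective _ v
    rw [Submodule.mem_dualCoannihilator] at hv
    have hv' : ∀ T, InK x T → T u = 0 := by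
      rintro T ⟨f, hf, hf'⟩
      rw [← hf']; exact hv f hf
    rw [Submodule.mem_bot, Submodule.Quotient.mk_eq_zero]
    refine mem_Twedge_of g hg u (fun p q r a b c => hv' _ (s2 p q r a b c)) fun p i j a b => ?_
    have := hv' _ (s3 p i j a b)
    exact sub_eq_zero.mp this
  have hK : K = ⊤ := by
    rw [← Subspace.dualCoannihilator_dualAnnihilator_eq (W := K), hK0]
    simp
  refine eq_zero_of_ctr (Module.finBasis ℚ (Lambda30 g)) 1 x hx2 fun i => ?_
  have : (Module.finBasis ℚ (Lambda30 g)).coord i ∈ K := by rw [hK]; trivial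
  exact this

lemma inj_part (hg : 3 ≤ g) (x : ExteriorAlgebra ℚ (Lambda30 g))
    (hx2 : x ∈ ⋀[ℚ]^2 (Lambda30 g))
    (hx : ∀ A, ∀ hA : A ∈ Matrix.symplecticGroup (Fin g) ℚ, ExteriorAlgebra.map (qact A hA) x = x)
    (i0 i1 i2 : Fin g) (h01 : i0 ≠ i1) (h02 : i0 ≠ i2) (h12 : i1 ≠ i2)
    (φ ψ : Module.Dual ℚ (Lambda30 g))
    (hφ : ∀ u, φ (Submodule.Quotient.mk u) =
      T3 (pr g (Sum.inl i0)) (pr g (Sum.inl i1)) (pr g (Sum.inl i2)) u)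
    (hψ : ∀ u, ψ (Submodule.Quotient.mk u) =
      T3 (pr g (Sum.inr i0)) (pr g (Sum.inr i1)) (pr g (Sum.inr i2)) u)
    (h0 : ExteriorAlgebra.algebraMapInv (ctr ψ (ctr φ x)) = 0) : x = 0 := by
  refine eq_zero_of_InK hg x hx2 hx i0 i1 i2 h01 h02 h12 ⟨φ, ?_, hφ⟩
  have hy := ctr_mem 1 φ x hx2
  simp only [ExteriorAlgebra.exteriorPower, pow_one] at hy
  obtain ⟨v, hv⟩ := hy
  obtain ⟨u, rfl⟩ := Submodule.Quotient.mk_surjective _ v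
  have hψu : T3 (pr g (Sum.inr i0)) (pr g (Sum.inr i1)) (pr g (Sum.inr i2)) u = 0 := by
    rw [← hψ, ← h0, ← hv, ctr_ι]
    exact (ExteriorAlgebra.algebraMap_leftInverse _ _).symm
  have tor : ∀ l : Fin g, (l = i0 ∨ l = i1 ∨ l = i2) →
      u - (2 : ℚ) • act3 g (Matrix.diagonal (wt l)) u ∈ Twedge g := by
    intro l hl
    have e1 : φ ∘ₗ qact _ (torus_mem l) = (2 : ℚ) • φ := by
      apply LinearMap.ext
      intro v
      obtain ⟨u, rfl⟩ := Submodule.Quotient.mk_surjective _ v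
      rw [LinearMap.comp_apply, qact_mk, hφ, T3_act, torus_pr, torus_pr, torus_pr, T3_apply,
        TE_smul, LinearMap.smul_apply, hφ, T3_apply, smul_eq_mul]
      congr 1
      rcases hl with rfl | rfl | rfl <;> simp [wt, h01, h02, h12, h01.symm, h02.symm, h12.symm]
    have e2 := ctr_map φ (qact _ (torus_mem l)) x
    rw [hx, e1, ctr_smul, map_smul, ← hv, ExteriorAlgebra.map_apply_ι, qact_mk, ← map_smul] at e2
    have e3 := ExteriorAlgebra.ι_leftInverse.injective e2
    rw [← Submodule.Quotient.mk_smul, Submodule.Quotient.eq] at e3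
    exact e3
  have tor2 : ∀ l : Fin g, (l = i0 ∨ l = i1 ∨ l = i2) → ∀ T : Module.Dual ℚ ↥(⋀[ℚ]^3 (H g)),
      (∀ t ∈ Twedge g, T t = 0) → ∀ s : ℚ, T (act3 g (Matrix.diagonal (wt l)) u) = s * T u →
      s ≠ 1/2 → T u = 0 := by
    intro l hl T hT s hs hs2
    have := hT _ (tor l hl)
    rw [map_sub, map_smul, hs, smul_eq_mul] at this
    have h3 : (1 - 2 * s) * T u = 0 := by linarith
    refine (mul_eq_zero.mp h3).resolve_left fun h => hs2 (by linarith)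
  have wT : ∀ l p q r, T3 (pr g p) (pr g q) (pr g r) (act3 g (Matrix.diagonal (wt l)) u) =
      (wt l p * wt l q * wt l r) * T3 (pr g p) (pr g q) (pr g r) u := by
    intro l p q r
    rw [T3_act, torus_pr, torus_pr, torus_pr, T3_apply, TE_smul, T3_apply]
  have wge : ∀ (l : Fin g) (p : Fin g ⊕ Fin g), p ≠ Sum.inr l → 1 ≤ wt l p := by
    intro l p hp
    rcases p with i | i
    · simp only [wt, Sum.elim_inl]; split_ifs <;> norm_num
    · have : i ≠ l := fun h => hp (by rw [h])
      simp [wt, this]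
  have hu : u ∈ Twedge g := by
    refine mem_Twedge_of g hg u (fun p q r a b c => ?_) fun p i j a b => ?_
    · by_cases hall : ∀ l, (l = i0 ∨ l = i1 ∨ l = i2) →
        (p = Sum.inr l ∨ q = Sum.inr l ∨ r = Sum.inr l)
      · have r0 := hall i0 (by simp)
        have r1 := hall i1 (by simp)
        have r2 := hall i2 (by simp)
        have z1 : ∀ d1 d2 d3 : Module.Dual ℚ (H g),
          TE d1 d2 d3 (u : ExteriorAlgebra ℚ (H g)) = 0 → TE d2 d1 d3 (u : ExteriorAlgebra ℚ (H g)) = 0 :=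
          fun d1 d2 d3 h => by rw [TE_swap12, h, neg_zero]
        have z2 : ∀ d1 d2 d3 : Module.Dual ℚ (H g),
          TE d1 d2 d3 (u : ExteriorAlgebra ℚ (H g)) = 0 → TE d1 d3 d2 (u : ExteriorAlgebra ℚ (H g)) = 0 :=
          fun d1 d2 d3 h => by rw [TE_swap23, h, neg_zero]
        rw [T3_apply] at hψu
        have q1 := z1 _ _ _ hψu
        have q2 := z2 _ _ _ hψu
        have q3 := z2 _ _ _ q1
        have q4 := z1 _ _ _ q2
        have q5 := z1 _ _ _ q3
        rcases r0 with rfl | rfl | rfl <;> rcases r1 with h | h | h <;>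
          rcases r2 with h' | h' | h' <;>
          first
          | exact absurd (Sum.inr.inj h) h01
          | exact absurd (Sum.inr.inj h') h02
          | exact absurd (Sum.inr.inj (h.symm.trans h')) h12
          | (subst h; subst h'; assumption)
      · push Not at hall
        obtain ⟨l, hl, n1, n2, n3⟩ := hall
        refine tor2 l hl _ (T3_iso p q r a b c) _ (wT l p q r) ?_
        have := wge l p n1
        have := wge l q n2
        have := wge l r n3
        have h5 : 1 ≤ wt l p * wt l q * wt l r := by
          have : 1 ≤ wt l p * wt l q := by nlinarith
          nlinarith
        intro h6; rw [h6] at h5; norm_num at h5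
    · obtain ⟨l, hl, hlp⟩ : ∃ l, (l = i0 ∨ l = i1 ∨ l = i2) ∧ l ≠ idx p := by
        by_cases e : i0 = idx p
        · exact ⟨i1, by simp, by rw [← e]; exact h01.symm⟩
        · exact ⟨i0, by simp, e⟩
      have hw : wt l p = 1 := by
        have hlp' := hlp.symm
        rcases p with k | k
        · have : k ≠ l := hlp'
          simp [wt, this]
        · have : k ≠ l := hlp'
          simp [wt, this]
      have hab : ∀ k : Fin g, wt l (Sum.inl k) * wt l (Sum.inr k) = 1 := by
        intro k; simp only [wt, Sum.elim_inl, Sum.elim_inr]; split_ifs <;> norm_num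
      have := tor2 l hl _ (T4_iso p i j a b) 1 ?_ (by norm_num)
      · exact sub_eq_zero.mp this
      · rw [T4, LinearMap.sub_apply, LinearMap.sub_apply, wT, wT, hw, one_mul, one_mul, hab, hab]
        ring
  rw [← hv, (Submodule.Quotient.mk_eq_zero _).mpr hu, map_zero]

end partD

section partE
variable {g : ℕ}

lemma mul3_mem (x y z : H g) : ιE g x * ιE g y * ιE g z ∈ ⋀[ℚ]^3 (H g) := by
  have h : ∀ y : H g, ιE g y ∈ LinearMap.range (ExteriorAlgebra.ι ℚ (M := H g)) := fun y => ⟨y, rfl⟩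
  rw [ExteriorAlgebra.exteriorPower, pow_succ, pow_two]
  exact Submodule.mul_mem_mul (Submodule.mul_mem_mul (h _) (h _)) (h _)

/-- The class of `x ∧ y ∧ z`, as an element of degree one. -/
def tt (x y z : H g) : ExteriorAlgebra ℚ (Lambda30 g) :=
  ExteriorAlgebra.ι ℚ ((Twedge g).mkQ ⟨ιE g x * ιE g y * ιE g z, mul3_mem x y z⟩)

lemma tt_add1 (x x' y z : H g) : tt (x + x') y z = tt x y z + tt x' y z := by
  rw [tt, tt, tt, ← map_add, ← map_add]
  congr 2; apply Subtype.ext; simp [add_mul]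
lemma tt_add2 (x y y' z : H g) : tt x (y + y') z = tt x y z + tt x y' z := by
  rw [tt, tt, tt, ← map_add, ← map_add]
  congr 2; apply Subtype.ext; simp [add_mul, mul_add]
lemma tt_add3 (x y z z' : H g) : tt x y (z + z') = tt x y z + tt x y z' := by
  rw [tt, tt, tt, ← map_add, ← map_add]
  congr 2; apply Subtype.ext; simp [mul_add]
lemma tt_smul1 (c : ℚ) (x y z : H g) : tt (c • x) y z = c • tt x y z := by
  rw [tt, tt, ← map_smul, ← map_smul]
  congr 2; apply Subtype.ext; simp
lemma tt_smul2 (c : ℚ) (x y z : H g) : tt x (c • y) z = c • tt x y z := by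
  rw [tt, tt, ← map_smul, ← map_smul]
  congr 2; apply Subtype.ext; simp
lemma tt_smul3 (c : ℚ) (x y z : H g) : tt x y (c • z) = c • tt x y z := by
  rw [tt, tt, ← map_smul, ← map_smul]
  congr 2; apply Subtype.ext; simp

/-- Basis vectors. -/
def ee (p : Fin g ⊕ Fin g) : H g := Sum.elim (aa g) (bb g) p
/-- Dual basis vectors. -/
def ee' (p : Fin g ⊕ Fin g) : H g := Sum.elim (bb g) (fun i => - aa g i) p

lemma sum_inv {N : Type*} [AddCommGroup N] [Module ℚ N] (F : H g → H g → N)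
    (h1 : ∀ x x' y, F (x + x') y = F x y + F x' y) (h2 : ∀ (c : ℚ) x y, F (c • x) y = c • F x y)
    (h3 : ∀ x y y', F x (y + y') = F x y + F x y') (h4 : ∀ (c : ℚ) x y, F x (c • y) = c • F x y)
    (A : Matrix (Fin g ⊕ Fin g) (Fin g ⊕ Fin g) ℚ)
    (hA : A ∈ Matrix.symplecticGroup (Fin g) ℚ) :
    ∑ p, F (A.mulVec (ee p)) (A.mulVec (ee' p)) = ∑ p, F (ee p) (ee' p) := by
  have h := bilin_inv g (LinearMap.mk₂ ℚ F h1 h2 h3 h4) A hA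
  simp only [LinearMap.mk₂_apply] at h
  have hneg : ∀ x y, F x (-y) = - F x y := fun x y => by
    have := h4 (-1) x y
    simpa using this
  simp only [Fintype.sum_sum_type, ee, ee', Sum.elim_inl, Sum.elim_inr, Matrix.mulVec_neg, hneg,
    Finset.sum_neg_distrib, ← sub_eq_add_neg]
  simpa only [Finset.sum_sub_distrib] using h

/-- The invariant element. -/
def w0 (g : ℕ) : ExteriorAlgebra ℚ (Lambda30 g) :=
  ∑ p, ∑ q, ∑ r, tt (ee p) (ee q) (ee r) * tt (ee' p) (ee' q) (ee' r)

lemma w0_mem : w0 g ∈ ⋀[ℚ]^2 (Lambda30 g) := by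
  refine Submodule.sum_mem _ fun p _ => Submodule.sum_mem _ fun q _ => Submodule.sum_mem _ fun r _ => ?_
  change _ ∈ LinearMap.range (ExteriorAlgebra.ι ℚ (M := Lambda30 g)) ^ 2
  rw [pow_two]
  exact Submodule.mul_mem_mul ⟨_, rfl⟩ ⟨_, rfl⟩

lemma map_tt (A : Matrix (Fin g ⊕ Fin g) (Fin g ⊕ Fin g) ℚ)
    (fq : Lambda30 g →ₗ[ℚ] Lambda30 g)
    (hfq : ∀ v : ↥(⋀[ℚ]^3 (H g)),
        fq (Submodule.Quotient.mk v) = Submodule.Quotient.mk (act3 g A v)) (x y z : H g) :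
    ExteriorAlgebra.map fq (tt x y z) = tt (A.mulVec x) (A.mulVec y) (A.mulVec z) := by
  rw [tt, ExteriorAlgebra.map_apply_ι, tt, Submodule.mkQ_apply, hfq, Submodule.mkQ_apply]
  congr 2
  apply Subtype.ext
  rw [act3_coe]
  simp [ExteriorAlgebra.map_apply_ι]

lemma w0_inv (A : Matrix (Fin g ⊕ Fin g) (Fin g ⊕ Fin g) ℚ)
    (hA : A ∈ Matrix.symplecticGroup (Fin g) ℚ)
    (fq : Lambda30 g →ₗ[ℚ] Lambda30 g)
    (hfq : ∀ v : ↥(⋀[ℚ]^3 (H g)),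
        fq (Submodule.Quotient.mk v) = Submodule.Quotient.mk (act3 g A v)) :
    ExteriorAlgebra.map fq (w0 g) = w0 g := by
  simp only [w0, map_sum, map_mul, map_tt A fq hfq]
  have e1 : ∀ x y x' y' : H g,
      ∑ r, tt x y (A.mulVec (ee r)) * tt x' y' (A.mulVec (ee' r)) =
      ∑ r, tt x y (ee r) * tt x' y' (ee' r) := fun x y x' y' =>
    sum_inv (fun z z' => tt x y z * tt x' y' z')
      (by intros; simp only [tt_add3, add_mul]) (by intros; simp only [tt_smul3, smul_mul_assoc])
      (by intros; simp only [tt_add3, mul_add]) (by intros; simp only [tt_smul3, mul_smul_comm]) A hA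
  have e2 : ∀ x x' : H g,
      ∑ q, ∑ r, tt x (A.mulVec (ee q)) (ee r) * tt x' (A.mulVec (ee' q)) (ee' r) =
      ∑ q, ∑ r, tt x (ee q) (ee r) * tt x' (ee' q) (ee' r) := fun x x' =>
    sum_inv (fun y y' => ∑ r, tt x y (ee r) * tt x' y' (ee' r))
      (by intros; simp only [tt_add2, add_mul, Finset.sum_add_distrib])
      (by intros; simp only [tt_smul2, smul_mul_assoc, Finset.smul_sum])
      (by intros; simp only [tt_add2, mul_add, Finset.sum_add_distrib])
      (by intros; simp only [tt_smul2, mul_smul_comm, Finset.smul_sum]) A hA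
  have e3 : 
      ∑ p, ∑ q, ∑ r, tt (A.mulVec (ee p)) (ee q) (ee r) * tt (A.mulVec (ee' p)) (ee' q) (ee' r) =
      ∑ p, ∑ q, ∑ r, tt (ee p) (ee q) (ee r) * tt (ee' p) (ee' q) (ee' r) :=
    sum_inv (fun y y' => ∑ q, ∑ r, tt y (ee q) (ee r) * tt y' (ee' q) (ee' r))
      (by intros; simp only [tt_add1, add_mul, Finset.sum_add_distrib])
      (by intros; simp only [tt_smul1, smul_mul_assoc, Finset.smul_sum])
      (by intros; simp only [tt_add1, mul_add, Finset.sum_add_distrib])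
      (by intros; simp only [tt_smul1, mul_smul_comm, Finset.smul_sum]) A hA
  simp only [e1, e2, e3]

lemma pr_ee'_inr (i : Fin g) (p : Fin g ⊕ Fin g) :
    pr g (Sum.inr i) (ee' p) = pr g (Sum.inl i) (ee p) := by
  rcases p with j | j <;> simp [ee, ee', aa, bb, Pi.single_apply]

lemma pr_ee'_inl (i : Fin g) (p : Fin g ⊕ Fin g) :
    pr g (Sum.inl i) (ee' p) = - pr g (Sum.inr i) (ee p) := by
  rcases p with j | j <;> simp [ee, ee', aa, bb, Pi.single_apply]

lemma ctr2_mul {M : Type*} [AddCommGroup M] [Module ℚ M] (φ ψ : Module.Dual ℚ M) (v v' : M) :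
    ExteriorAlgebra.algebraMapInv (ctr ψ (ctr φ (ExteriorAlgebra.ι ℚ v * ExteriorAlgebra.ι ℚ v'))) =
    φ v * ψ v' - φ v' * ψ v := by
  have key : ∀ (d : Module.Dual ℚ M) (x : M),
      ctr d (ExteriorAlgebra.ι ℚ x) = d x • (1 : ExteriorAlgebra ℚ M) := fun d x => by
    rw [ctr_ι, Algebra.algebraMap_eq_smul_one]
  simp only [ctr_ι_mul, key, map_sub, map_smul, mul_one, mul_smul_comm, map_one, smul_eq_mul]

lemma w0_pos (i0 i1 i2 : Fin g) (h01 : i0 ≠ i1) (h02 : i0 ≠ i2) (h12 : i1 ≠ i2)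
    (φ ψ : Module.Dual ℚ (Lambda30 g))
    (hφ : ∀ u, φ (Submodule.Quotient.mk u) =
      T3 (pr g (Sum.inl i0)) (pr g (Sum.inl i1)) (pr g (Sum.inl i2)) u)
    (hψ : ∀ u, ψ (Submodule.Quotient.mk u) =
      T3 (pr g (Sum.inr i0)) (pr g (Sum.inr i1)) (pr g (Sum.inr i2)) u) :
    0 < ExteriorAlgebra.algebraMapInv (ctr ψ (ctr φ (w0 g))) := by
  have term : ∀ p q r, ExteriorAlgebra.algebraMapInv (ctr ψ (ctr φ
      (tt (ee p) (ee q) (ee r) * tt (ee' p) (ee' q) (ee' r)))) =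
      (TE (pr g (Sum.inl i0)) (pr g (Sum.inl i1)) (pr g (Sum.inl i2))
        (ιE g (ee p) * ιE g (ee q) * ιE g (ee r))) ^ 2 +
      (TE (pr g (Sum.inr i0)) (pr g (Sum.inr i1)) (pr g (Sum.inr i2))
        (ιE g (ee p) * ιE g (ee q) * ιE g (ee r))) ^ 2 := by
    intro p q r
    rw [tt, tt, ctr2_mul]
    simp only [Submodule.mkQ_apply, hφ, hψ, T3_apply, TE_ι3, pr_ee'_inl, pr_ee'_inr]
    ring
  simp only [w0, map_sum, term]
  have n3 : ∀ p q r, 0 ≤ (TE (pr g (Sum.inl i0)) (pr g (Sum.inl i1)) (pr g (Sum.inl i2))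
        (ιE g (ee p) * ιE g (ee q) * ιE g (ee r))) ^ 2 +
      (TE (pr g (Sum.inr i0)) (pr g (Sum.inr i1)) (pr g (Sum.inr i2))
        (ιE g (ee p) * ιE g (ee q) * ιE g (ee r))) ^ 2 := fun p q r => by positivity
  refine Finset.sum_pos' (fun p _ => Finset.sum_nonneg fun q _ => Finset.sum_nonneg fun r _ => n3 p q r)
    ⟨Sum.inl i0, Finset.mem_univ _, ?_⟩
  refine Finset.sum_pos' (fun q _ => Finset.sum_nonneg fun r _ => n3 _ q r)
    ⟨Sum.inl i1, Finset.mem_univ _, ?_⟩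
  refine Finset.sum_pos' (fun r _ => n3 _ _ r) ⟨Sum.inl i2, Finset.mem_univ _, ?_⟩
  refine add_pos_of_pos_of_nonneg ?_ (sq_nonneg _)
  rw [TE_ι3]
  simp [ee, aa, Pi.single_apply, h01, h02, h12, h01.symm, h02.symm, h12.symm]

end partE

/-- For `g ≥ 3`, the subspace of `Sp_{2g}(ℚ)`-invariant vectors in `⋀²(Λ³₀H)` is
one-dimensional: the trivial representation `V(0)` occurs with multiplicity exactly one
in `⋀²V(λ₃)`. -/
theorem invariants_rank_one (g : ℕ) (hg : 3 ≤ g) :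
    Module.finrank ℚ ↥(invariants g) = 1 := by
  let i0 : Fin g := ⟨0, by omega⟩
  let i1 : Fin g := ⟨1, by omega⟩
  let i2 : Fin g := ⟨2, by omega⟩
  have h01 : i0 ≠ i1 := by simp [i0, i1]
  have h02 : i0 ≠ i2 := by simp [i0, i2]
  have h12 : i1 ≠ i2 := by simp [i1, i2]
  let φ : Module.Dual ℚ (Lambda30 g) := (Twedge g).liftQ
    (T3 (pr g (Sum.inl i0)) (pr g (Sum.inl i1)) (pr g (Sum.inl i2)))
    (T3_iso (Sum.inl i0) (Sum.inl i1) (Sum.inl i2) h01 h02 h12)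
  let ψ : Module.Dual ℚ (Lambda30 g) := (Twedge g).liftQ
    (T3 (pr g (Sum.inr i0)) (pr g (Sum.inr i1)) (pr g (Sum.inr i2)))
    (T3_iso (Sum.inr i0) (Sum.inr i1) (Sum.inr i2) h01 h02 h12)
  have hφ : ∀ u, φ (Submodule.Quotient.mk u) =
      T3 (pr g (Sum.inl i0)) (pr g (Sum.inl i1)) (pr g (Sum.inl i2)) u := fun u => rfl
  have hψ : ∀ u, ψ (Submodule.Quotient.mk u) =
      T3 (pr g (Sum.inr i0)) (pr g (Sum.inr i1)) (pr g (Sum.inr i2)) u := fun u => rfl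
  let L : ExteriorAlgebra ℚ (Lambda30 g) →ₗ[ℚ] ℚ :=
    ExteriorAlgebra.algebraMapInv.toLinearMap ∘ₗ ctr ψ ∘ₗ ctr φ
  have hLpos : 0 < L (w0 g) := w0_pos i0 i1 i2 h01 h02 h12 φ ψ hφ hψ
  have hinj : ∀ w : ↥(invariants g), L ((w : ↥(⋀[ℚ]^2 (Lambda30 g))) : ExteriorAlgebra ℚ (Lambda30 g)) = 0 →
      w = 0 := by
    intro w hw
    apply Subtype.ext
    apply Subtype.ext
    refine inj_part hg _ w.1.2 ?_ i0 i1 i2 h01 h02 h12 φ ψ hφ hψ hw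
    intro A hA
    exact congrArg Subtype.val (w.2 A hA (qact A hA) (qact_mk A hA))
  let W : ↥(invariants g) := ⟨⟨w0 g, w0_mem⟩, fun A hA fq hfq =>
    Subtype.ext (w0_inv A hA fq hfq)⟩
  refine finrank_eq_one W ?_ fun w => ⟨L w.1.1 / L (w0 g), ?_⟩
  · intro h
    have : w0 g = 0 := congrArg (fun z : ↥(invariants g) => z.1.1) h
    rw [this, map_zero] at hLpos
    exact lt_irrefl _ hLpos
  · rw [← sub_eq_zero]
    apply hinj
    change L ((L w.1.1 / L (w0 g)) • w0 g - w.1.1) = 0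
    rw [map_sub, map_smul, smul_eq_mul, div_mul_cancel₀ _ hLpos.ne', sub_self]
end
end

section
/- Let g ≥ 1 and let P be a polynomial with rational coefficients in the (2g)² matrix-entry variables x_{ij}, 1 ≤ i,j ≤ 2g. If P vanishes at every matrix A ∈ Sp_{2g}(ℤ) (i.e., at every 2g×2g integer matrix A with AᵀJA = J, evaluated after coercing the entries to ℚ), then P vanishes at every matrix B ∈ Sp_{2g}(ℚ) (i.e., every 2g×2g rational matrix B with BᵀJB = J). In other words, Sp_{2g}(ℤ) is Zariski dense in Sp_{2g}(ℚ). -/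
open Matrix

namespace SpDense

section
variable {l : Type*} [DecidableEq l] [Fintype l]

lemma exists_symmetric_X_invertible_add_mul_of_ker_inter_eq_bot {R : Type*} [Field R]
    {A C : Matrix l l R} (hker : ∀ (x : l → R), (A • x = 0) → (C • x = 0) → x = 0)
    (hsymm : Aᵀ * C = Cᵀ * A) :
    ∃ (X : Matrix l l R), X.IsSymm ∧ IsUnit (A + X * C) := by
  -- `C` is transformed into `P = fromBlocks 1 0 0 0` by invertible matrices `V` and `U`.
  rcases exists_rank_normal_form C with ⟨V, U, s, hV, hU, heq⟩
  set P := V * C * U with P_def; set Q := Vᵀ⁻¹ * A * U with Q_def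
  set f := fun (x : Matrix l l R) ↦ x.submatrix s.symm s.symm
  have hf (x) : f x = x.submatrix s.symm s.symm := rfl
  have f_unit {x} : IsUnit x → IsUnit (f x) := (isUnit_submatrix_equiv ..).2
  have f_mul (x y) : f (x * y) = f x * f y := submatrix_mul _ _ _ _ _ s.symm.bijective
  have _ : Invertible V := hV.invertible
  have _ : Invertible U := hU.invertible
  have _ : Invertible (f Vᵀ) := (f_unit (V.isUnit_transpose.2 hV)).invertible
  -- The hypothesis that the only vector annihilated by both matrices is 0, holds for `P` and `Q`.
  have con1 (x : Fin C.rank ⊕ Fin (Fintype.card l - C.rank) → R)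
      (heq1 : (f Q) • x = 0) (heq2 : (f P) • x = 0) : x = 0 := by
    refine (f_unit hU).smul_left_cancel.1 ?_
    rw [f_mul, f_mul, mul_assoc, mul_smul, IsUnit.smul_eq_zero, mul_smul, hf,
      smul_eq_mulVec, submatrix_mulVec_equiv, Equiv.symm_symm] at heq1 heq2
    · rw [Equiv.comp_symm_eq, Pi.zero_comp] at heq1 heq2
      exact s.surjective.injective_comp_right <| by simpa using hker _ heq1 heq2
    · exact f_unit hV
    · exact f_unit <| isUnit_nonsing_inv_iff.2 <| V.isUnit_transpose.2 hV
  -- The symmetry relation also holds for `P` and `Q`.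
  have con2 : Qᵀ * P = Pᵀ * Q := by
    simp only [P_def, mul_assoc, transpose_mul, transpose_nonsing_inv, transpose_transpose, Q_def,
      inv_mul_cancel_left_of_invertible, mul_inv_cancel_left_of_invertible]
    rw [← mul_assoc Aᵀ, hsymm, mul_assoc]
  replace con2 : (f Q).toBlocks₁₁ᵀ = (f Q).toBlocks₁₁ ∧ (f Q).toBlocks₁₂ = 0 := by
    apply_fun reindex s s at con2
    rw [reindex_apply, reindex_apply, ← hf, ← hf, f_mul, f_mul Pᵀ, heq, hf,
      ← transpose_submatrix, ← hf Q, ← (f Q).fromBlocks_toBlocks, hf (_)ᵀ, hf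
      ((fromBlocks 1 0 0 0).submatrix _ _)] at con2
    simp [fromBlocks_transpose, fromBlocks_multiply] at con2; tauto
  -- The lower-right block of `Q` is invertible.
  have con3 : IsUnit (f Q).toBlocks₂₂ := by
    refine mulVec_injective_iff_isUnit.1 ?_
    rw [← coe_mulVecLin, ← LinearMap.ker_eq_bot]
    refine ker_mulVecLin_eq_bot_iff.2 fun x hx ↦ Sum.elim_injective' <|
      (con1 _ ?_ ?_).trans Sum.elim_zero_zero.symm
    · rw [← (f Q).fromBlocks_toBlocks]; simp [hx, con2.2, fromBlocks_mulVec]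
    · simp [hf, heq, fromBlocks_mulVec]
  set Y : Matrix (Fin C.rank ⊕ Fin (Fintype.card l - C.rank)) (Fin C.rank ⊕
    Fin (Fintype.card l - C.rank)) R := fromBlocks (1 - (f Q).toBlocks₁₁) 0 0 0 with Y_def
  have hY_symm : Y.IsSymm := by
    rw [Y_def, isSymm_fromBlocks_iff]
    exact ⟨IsSymm.sub isSymm_one con2.1, by simp⟩
  -- We now take `X = Vᵀ * Y * V` and this gives the desired matrix `X.submatrix s s`.
  set X := (f Vᵀ) * Y * (f V) with X_def
  refine ⟨X.submatrix s s, IsSymm.submatrix ?_ s, (isUnit_submatrix_equiv s.symm s.symm).1 ?_⟩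
  · simp_rw [X_def, Matrix.IsSymm, transpose_mul, hY_symm.eq, hf, transpose_submatrix,
      transpose_transpose, mul_assoc]
  · have heq' : f (A + X.submatrix s s * C) = (f Vᵀ) * (f Q + Y * (f P)) * f (U⁻¹) := by
      simp_rw [hf, submatrix_add, Pi.add_apply, Q_def, P_def, ← hf, f_mul, hf, mul_add, ← mul_assoc,
        ← inv_submatrix_equiv, add_mul, mul_assoc _ (U.submatrix _ _), mul_inv_of_invertible]
      simp [X_def]; rfl
    rw [← hf, heq', IsUnit.mul_iff, IsUnit.mul_iff]
    refine ⟨⟨isUnit_of_invertible _, ?_⟩, ?_⟩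
    · nth_rw 1 [Y_def, heq, ← (f Q).fromBlocks_toBlocks, con2.2]
      simpa [hf, fromBlocks_multiply, fromBlocks_add]
    · exact f_unit <| isUnit_nonsing_inv_iff.2 hU

end

variable {g : ℕ}

/-- Zariski closure of the integral symplectic group. -/
def Z (g : ℕ) : Set (Matrix (Fin g ⊕ Fin g) (Fin g ⊕ Fin g) ℚ) :=
  {M | ∀ P : MvPolynomial ((Fin g ⊕ Fin g) × (Fin g ⊕ Fin g)) ℚ,
    (∀ A ∈ symplecticGroup (Fin g) ℤ,
      MvPolynomial.eval (fun p => ((A p.1 p.2 : ℤ) : ℚ)) P = 0) →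
    MvPolynomial.eval (fun p => M p.1 p.2) P = 0}

lemma poly_mul (P : MvPolynomial ((Fin g ⊕ Fin g) × (Fin g ⊕ Fin g)) ℚ)
    (N : Matrix (Fin g ⊕ Fin g) (Fin g ⊕ Fin g) ℚ) :
    (∃ Q : MvPolynomial ((Fin g ⊕ Fin g) × (Fin g ⊕ Fin g)) ℚ,
      ∀ M : Matrix (Fin g ⊕ Fin g) (Fin g ⊕ Fin g) ℚ,
        MvPolynomial.eval (fun p => M p.1 p.2) Q =
          MvPolynomial.eval (fun p => (M * N) p.1 p.2) P) ∧
    (∃ Q : MvPolynomial ((Fin g ⊕ Fin g) × (Fin g ⊕ Fin g)) ℚ,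
      ∀ M : Matrix (Fin g ⊕ Fin g) (Fin g ⊕ Fin g) ℚ,
        MvPolynomial.eval (fun p => M p.1 p.2) Q =
          MvPolynomial.eval (fun p => (N * M) p.1 p.2) P) := by
  constructor
  · refine ⟨MvPolynomial.bind₁ (fun p => ∑ k, MvPolynomial.X (p.1, k) *
      MvPolynomial.C (N k p.2)) P, fun M => ?_⟩
    rw [← MvPolynomial.coe_aeval_eq_eval, ← MvPolynomial.coe_aeval_eq_eval]
    simp only [RingHom.coe_coe]
    rw [MvPolynomial.aeval_bind₁]
    congr 2
    funext p
    simp [Matrix.mul_apply]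
  · refine ⟨MvPolynomial.bind₁ (fun p => ∑ k, MvPolynomial.C (N p.1 k) *
      MvPolynomial.X (k, p.2)) P, fun M => ?_⟩
    rw [← MvPolynomial.coe_aeval_eq_eval, ← MvPolynomial.coe_aeval_eq_eval]
    simp only [RingHom.coe_coe]
    rw [MvPolynomial.aeval_bind₁]
    congr 2
    funext p
    simp [Matrix.mul_apply]

lemma Z_mul {M N : Matrix (Fin g ⊕ Fin g) (Fin g ⊕ Fin g) ℚ} (hM : M ∈ Z g) (hN : N ∈ Z g) :
    M * N ∈ Z g := by
  intro P hP
  obtain ⟨Q, hQ⟩ := (poly_mul P N).1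
  rw [← hQ M]
  refine hM Q fun A hA => ?_
  refine (hQ (A.map (Int.castRingHom ℚ))).trans ?_
  obtain ⟨R, hR⟩ := (poly_mul P (A.map (Int.castRingHom ℚ))).2
  rw [← hR N]
  refine hN R fun B hB => ?_
  refine (hR (B.map (Int.castRingHom ℚ))).trans ?_
  rw [← Matrix.map_mul]
  exact hP _ (mul_mem hA hB)

lemma Z_line (N : Matrix (Fin g ⊕ Fin g) (Fin g ⊕ Fin g) ℤ)
    (hN : ∀ t : ℤ, 1 + t • N ∈ symplecticGroup (Fin g) ℤ) (c : ℚ) :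
    1 + c • N.map (Int.castRingHom ℚ) ∈ Z g := by
  intro P hP
  let p : Polynomial ℚ := MvPolynomial.aeval
    (fun q : (Fin g ⊕ Fin g) × (Fin g ⊕ Fin g) =>
      Polynomial.C ((1 : Matrix (Fin g ⊕ Fin g) (Fin g ⊕ Fin g) ℚ) q.1 q.2) +
        Polynomial.X * Polynomial.C ((N q.1 q.2 : ℤ) : ℚ)) P
  have hp (t : ℚ) : p.eval t =
      MvPolynomial.eval (fun q => (1 + t • N.map (Int.castRingHom ℚ)) q.1 q.2) P := by
    rw [← MvPolynomial.coe_aeval_eq_eval, RingHom.coe_coe, ← Polynomial.coe_aeval_eq_eval]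
    simp only [p]
    rw [← AlgHom.comp_apply, MvPolynomial.comp_aeval]
    congr 2
    funext q
    simp
  rw [← hp]
  have : p = 0 := by
    refine Polynomial.eq_zero_of_infinite_isRoot p
      (Set.Infinite.mono ?_ (Set.infinite_range_of_injective (Int.cast_injective (α := ℚ))))
    rintro _ ⟨t, rfl⟩
    change p.eval _ = 0
    rw [hp, ← hP _ (hN t)]
    congr 2
    funext q
    by_cases h : q.1 = q.2 <;> simp [h, -zsmul_eq_mul]
  simp [this]

lemma exists_int (X : Matrix (Fin g) (Fin g) ℚ) (hX : X.IsSymm) :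
    ∃ (Y : Matrix (Fin g) (Fin g) ℤ) (c : ℚ), Y.IsSymm ∧ X = c • Y.map (Int.castRingHom ℚ) := by
  obtain ⟨b, hb⟩ := IsLocalization.exist_integer_multiples_of_finite (nonZeroDivisors ℤ)
    (fun q : Fin g × Fin g => X q.1 q.2)
  have hb0 : ((b : ℤ) : ℚ) ≠ 0 := by exact_mod_cast nonZeroDivisors.ne_zero b.2
  choose y hy using hb
  have hy' (i j) : ((y (i, j) : ℤ) : ℚ) = ((b : ℤ) : ℚ) * X i j := by simpa using hy (i, j)
  refine ⟨Matrix.of fun i j => y (i, j), ((b : ℤ) : ℚ)⁻¹, ?_, ?_⟩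
  · ext i j
    have : ((y (j, i) : ℤ) : ℚ) = y (i, j) := by rw [hy', hy', hX.apply]
    simpa using this
  · ext i j
    simp [hy', hb0]

lemma U_mem {X : Matrix (Fin g) (Fin g) ℚ} (hX : X.IsSymm) : fromBlocks 1 X 0 1 ∈ Z g := by
  obtain ⟨Y, c, hY, rfl⟩ := exists_int X hX
  convert Z_line (fromBlocks 0 Y 0 0) (fun t => ?_) c
  · rw [← fromBlocks_one, fromBlocks_map, fromBlocks_smul, fromBlocks_add]
    simp
  · rw [← fromBlocks_one, fromBlocks_smul, fromBlocks_add, SymplecticGroup.fromBlocks_mem_iff]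
    simp [hY.eq, -zsmul_eq_mul]

lemma L_mem {X : Matrix (Fin g) (Fin g) ℚ} (hX : X.IsSymm) : fromBlocks 1 0 X 1 ∈ Z g := by
  obtain ⟨Y, c, hY, rfl⟩ := exists_int X hX
  convert Z_line (fromBlocks 0 0 Y 0) (fun t => ?_) c
  · rw [← fromBlocks_one, fromBlocks_map, fromBlocks_smul, fromBlocks_add]
    simp
  · rw [← fromBlocks_one, fromBlocks_smul, fromBlocks_add, SymplecticGroup.fromBlocks_mem_iff]
    simp [hY.eq, -zsmul_eq_mul]

lemma W_mem {S T : Matrix (Fin g) (Fin g) ℚ} (hS : S.IsSymm) (hT : T.IsSymm)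
    (h : S * T = 1) : fromBlocks 0 S (-T) 0 ∈ Z g := by
  have h' : T * S = 1 := mul_eq_one_comm.1 h
  convert Z_mul (Z_mul (U_mem hS) (L_mem hT.neg)) (U_mem hS) using 1
  simp [fromBlocks_multiply, h, h']

lemma levi_mem (A : Matrix (Fin g) (Fin g) ℚ) (hA : A.det ≠ 0) :
    fromBlocks A 0 0 (Aᵀ)⁻¹ ∈ Z g := by
  refine Matrix.diagonal_transvection_induction_of_det_ne_zero
    (fun A => fromBlocks A 0 0 (Aᵀ)⁻¹ ∈ Z g) A hA ?_ ?_ ?_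
  · intro D hD
    have hD' : ∀ i, D i ≠ 0 := by
      simpa [Matrix.det_diagonal, Finset.prod_ne_zero_iff] using hD
    have h1 : diagonal D * diagonal (fun i => (D i)⁻¹) = 1 := by
      simp [Matrix.diagonal_mul_diagonal, hD']
    have e : ((diagonal D)ᵀ)⁻¹ = diagonal (fun i => (D i)⁻¹) := by
      rw [diagonal_transpose]; exact inv_eq_right_inv h1
    rw [e]
    convert Z_mul (W_mem (isSymm_diagonal D) (isSymm_diagonal _) h1)
      (W_mem (S := (-1 : Matrix (Fin g) (Fin g) ℚ)) (T := -1) isSymm_one.neg isSymm_one.neg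
        (by simp)) using 1
    simp [fromBlocks_multiply]
  · rintro ⟨i, j, hij, c⟩
    have e : ((TransvectionStruct.mk i j hij c).toMatrixᵀ)⁻¹ = 1 - single j i c := by
      refine inv_eq_right_inv ?_
      simp [TransvectionStruct.toMatrix, transvection, mul_sub, add_mul, hij, hij.symm]
    beta_reduce
    rw [e]
    convert Z_line (fromBlocks (single i j 1) 0 0 (-single j i 1)) (fun t => ?_) c using 1
    · rw [← fromBlocks_one, fromBlocks_map, fromBlocks_smul, fromBlocks_add]
      simp [TransvectionStruct.toMatrix, transvection, sub_eq_add_neg, Matrix.map_neg]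
      constructor <;> ext a b <;> simp [Matrix.single_apply]
    · rw [← fromBlocks_one, fromBlocks_smul, fromBlocks_add, SymplecticGroup.fromBlocks_mem_iff]
      simp [mul_add, add_mul, hij, -zsmul_eq_mul]
  · intro A B hA hB h1 h2
    convert Z_mul h1 h2 using 1
    simp [fromBlocks_multiply, Matrix.mul_inv_rev]

lemma mem_of_unit {A B C D : Matrix (Fin g) (Fin g) ℚ}
    (h : fromBlocks A B C D ∈ symplecticGroup (Fin g) ℚ) (hA : IsUnit A) :
    fromBlocks A B C D ∈ Z g := by
  obtain ⟨h1, h2, h3⟩ := SymplecticGroup.fromBlocks_mem_iff.1 h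
  obtain ⟨k1, k2, k3⟩ := SymplecticGroup.fromBlocks_mem_iff.1
    (by simpa [fromBlocks_transpose] using SymplecticGroup.transpose_mem h)
  simp only [transpose_transpose] at k1 k2 k3
  have hd : IsUnit A.det := (isUnit_iff_isUnit_det A).1 hA
  have hdt : IsUnit Aᵀ.det := by rwa [det_transpose]
  have hX : (C * A⁻¹).IsSymm := by
    have : Aᵀ⁻¹ * (Aᵀ * C) * A⁻¹ = Aᵀ⁻¹ * (Cᵀ * A) * A⁻¹ := by rw [h1]
    rw [nonsing_inv_mul_cancel_left _ _ hdt, ← Matrix.mul_assoc,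
      mul_nonsing_inv_cancel_right _ _ hd] at this
    rw [Matrix.IsSymm, transpose_mul, transpose_nonsing_inv, this]
  have hY : (A⁻¹ * B).IsSymm := by
    have : A⁻¹ * (A * Bᵀ) * Aᵀ⁻¹ = A⁻¹ * (B * Aᵀ) * Aᵀ⁻¹ := by rw [k1]
    rw [nonsing_inv_mul_cancel_left _ _ hd, ← Matrix.mul_assoc,
      mul_nonsing_inv_cancel_right _ _ hdt] at this
    rw [Matrix.IsSymm, transpose_mul, transpose_nonsing_inv, this]
  have hD : D = C * (A⁻¹ * B) + Aᵀ⁻¹ := by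
    have : Aᵀ⁻¹ * (Aᵀ * D - Cᵀ * B) = Aᵀ⁻¹ := by rw [h3, Matrix.mul_one]
    rw [Matrix.mul_sub, nonsing_inv_mul_cancel_left _ _ hdt, ← Matrix.mul_assoc] at this
    have e := hX.eq
    rw [transpose_mul, transpose_nonsing_inv] at e
    rw [e, Matrix.mul_assoc] at this
    rw [← this]; abel
  convert Z_mul (Z_mul (L_mem hX) (levi_mem A hd.ne_zero)) (U_mem hY) using 1
  simp [fromBlocks_multiply, nonsing_inv_mul_cancel_right _ _ hd,
    mul_nonsing_inv_cancel_left _ _ hd, ← hD]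

lemma mem_Z (M : Matrix (Fin g ⊕ Fin g) (Fin g ⊕ Fin g) ℚ)
    (hM : M ∈ symplecticGroup (Fin g) ℚ) : M ∈ Z g := by
  obtain ⟨A, B, C, D, rfl⟩ : ∃ A B C D, M = fromBlocks A B C D :=
    ⟨_, _, _, _, (fromBlocks_toBlocks M).symm⟩
  have hU : IsUnit (fromBlocks A B C D) :=
    (isUnit_iff_isUnit_det _).2 (SymplecticGroup.symplectic_det hM)
  obtain ⟨X, hX, hu⟩ := exists_symmetric_X_invertible_add_mul_of_ker_inter_eq_bot
    (A := A) (C := C) (fun x hx1 hx2 => by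
      have hv0 : fromBlocks A B C D *ᵥ (Sum.elim x 0) =
          fromBlocks A B C D *ᵥ (Sum.elim 0 0) := by
        rw [smul_eq_mulVec] at hx1 hx2
        simp [fromBlocks_mulVec, hx1, hx2]
      exact (Sum.elim_eq_iff.1 (mulVec_injective_iff_isUnit.2 hU hv0)).1)
    (SymplecticGroup.fromBlocks_mem_iff.1 hM).1
  have e : fromBlocks 1 X 0 1 * fromBlocks A B C D =
      fromBlocks (A + X * C) (B + X * D) C D := by
    simp [fromBlocks_multiply]
  have hs : fromBlocks 1 X 0 1 ∈ symplecticGroup (Fin g) ℚ := by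
    rw [SymplecticGroup.fromBlocks_mem_iff]; simp [hX.eq]
  have := mem_of_unit (e ▸ mul_mem hs hM) hu
  convert Z_mul (U_mem hX.neg) this using 1
  rw [← e, ← Matrix.mul_assoc]
  simp [fromBlocks_multiply]

end SpDense


/-- `Sp_{2g}(ℤ)` is Zariski dense in `Sp_{2g}(ℚ)`: every polynomial in the matrix
entries with rational coefficients that vanishes on all integral symplectic matrices
also vanishes on all rational symplectic matrices. -/
theorem symplecticGroup_int_zariskiDense_in_rat (g : ℕ) (hg : 1 ≤ g)
    (P : MvPolynomial ((Fin g ⊕ Fin g) × (Fin g ⊕ Fin g)) ℚ)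
    (hvanish : ∀ A ∈ Matrix.symplecticGroup (Fin g) ℤ,
      MvPolynomial.eval (fun p => ((A p.1 p.2 : ℤ) : ℚ)) P = 0) :
    ∀ B ∈ Matrix.symplecticGroup (Fin g) ℚ,
      MvPolynomial.eval (fun p => B p.1 p.2) P = 0 := by
  exact fun B hB => SpDense.mem_Z B hB P hvanish
end

section
/- Let n ≥ 1. Let X := {z ∈ ℂ : z ≠ 0 and z ≠ 1} with the subspace topology, and let C_n(X) := {f : Fin n → X : f is injective}, topologized as a subspace of the product space X^{Fin n} (the configuration space of n labelled points in the twice-punctured plane). Then for every basepoint c ∈ C_n(X), the fundamental group π₁(C_n(X), c) is finitely generated. (This is the claim, used in the genus 0 case of the appendix, that the fiber of the forgetful map M_{0,n} → M_{0,4} — a hyperplane complement — has finitely generated fundamental group, so that Γ_{0,n} is an extension of a free group of rank 2 by a finitely generated group.) -/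
open CategoryTheory in
/-- The homotopy class of a path as an arrow of the fundamental groupoid. -/
noncomputable def pathCls {X : Type*} [TopologicalSpace X] {a b : X} (p : Path a b) :
    FundamentalGroupoid.mk a ⟶ FundamentalGroupoid.mk b :=
  Path.Homotopic.Quotient.mk p

open CategoryTheory in
theorem pathCls_trans {X : Type*} [TopologicalSpace X] {a b c : X} (p : Path a b) (q : Path b c) :
    pathCls (p.trans q) = pathCls p ≫ pathCls q := rfl

theorem pathCls_eq {X : Type*} [TopologicalSpace X] {a b : X} {p q : Path a b}
    (h : p.Homotopic q) : pathCls p = pathCls q :=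
  Path.Homotopic.Quotient.eq.mpr h

/-- A property of paths that is local with respect to an open cover and closed under
concatenation and homotopy holds for all paths. -/
theorem path_induct {X ι : Type*} [TopologicalSpace X] (U : ι → Set X)
    (hU : ∀ i, IsOpen (U i)) (hcov : ∀ x, ∃ i, x ∈ U i)
    (R : ∀ a b : X, Path a b → Prop)
    (htrans : ∀ a b c p q, R a b p → R b c q → R a c (p.trans q))
    (hhom : ∀ a b p q, p.Homotopic q → R a b p → R a b q)
    (hloc : ∀ i a b (p : Path a b), (∀ t, p t ∈ U i) → R a b p)
    (a b : X) (p : Path a b) : R a b p := by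
  obtain ⟨t, ht0, hmono, ⟨N, hN⟩, hsub⟩ :=
    exists_monotone_Icc_subset_open_cover_unitInterval (c := fun i => p ⁻¹' U i)
      (fun i => (hU i).preimage p.continuous)
      (fun s _ => by
        obtain ⟨i, hi⟩ := hcov (p s)
        exact Set.mem_iUnion.mpr ⟨i, hi⟩)
  have key : ∀ k, R _ _ (p.subpath 0 (t k)) := by
    intro k
    induction k with
    | zero =>
      rw [ht0, Path.subpath_self]
      obtain ⟨i, hi⟩ := hcov (p 0)
      exact hloc i _ _ _ (fun _ => hi)
    | succ k ih =>
      refine hhom _ _ _ _ ⟨Path.Homotopy.subpathTransSubpath p 0 (t k) (t (k+1))⟩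
        (htrans _ _ _ _ _ ih ?_)
      obtain ⟨i, hi⟩ := hsub k
      refine hloc i _ _ _ (fun s => ?_)
      have : (p.subpath (t k) (t (k+1))) s ∈ Set.range (p.subpath (t k) (t (k+1))) := ⟨s, rfl⟩
      rw [Path.range_subpath_of_le _ _ _ (hmono (Nat.le_succ k))] at this
      obtain ⟨r, hr, hr'⟩ := this
      rw [← hr']
      exact hi hr
  have h1 := key N
  rw [hN N le_rfl, Path.subpath_zero_one] at h1
  have gen : ∀ (a' b' : X) (ha : a' = a) (hb : b' = b), R a' b' (p.cast ha hb) → R a b p := by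
    rintro _ _ rfl rfl h
    exact h
  exact gen _ _ _ _ h1

open CategoryTheory in
/-- The generation half of van Kampen for finite good covers. -/
theorem fundamentalGroup_fg_of_cover {X ι : Type*} [TopologicalSpace X] [Finite ι] (U : ι → Set X)
    (hU : ∀ i, IsOpen (U i)) (hcov : ∀ x, ∃ i, x ∈ U i)
    (hsc : ∀ i a b (p q : Path a b), (∀ t, p t ∈ U i) → (∀ t, q t ∈ U i) → p.Homotopic q)
    (hint : ∀ i j a b, a ∈ U i → a ∈ U j → b ∈ U i → b ∈ U j →
      ∃ p : Path a b, (∀ t, p t ∈ U i) ∧ (∀ t, p t ∈ U j))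
    (x : X) : Group.FG (FundamentalGroup X x) := by
  classical
  have ht : ∀ i, ∃ t : ∀ y, y ∈ U i → Joined x y →
      (FundamentalGroupoid.mk x ⟶ FundamentalGroupoid.mk y),
      ∀ y y' hy hj hy' hj' (p : Path y y'), (∀ s, p s ∈ U i) →
        t y hy hj ≫ pathCls p = t y' hy' hj' := by
    intro i
    by_cases h : ∃ y, y ∈ U i ∧ Joined x y
    · obtain ⟨y₀, hy₀, ⟨γ⟩⟩ := h
      choose q hq _ using fun y (hy : y ∈ U i) => hint i i y₀ y hy₀ hy₀ hy hy
      refine ⟨fun y hy _ => pathCls γ ≫ pathCls (q y hy), ?_⟩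
      intro y y' hy _ hy' _ p hp
      rw [Category.assoc, ← pathCls_trans]
      congr 1
      refine pathCls_eq (hsc i _ _ _ _ (fun s => ?_) (hq _ _))
      have : ((q y hy).trans p) s ∈ Set.range ((q y hy).trans p) := ⟨s, rfl⟩
      rw [Path.trans_range] at this
      rcases this with ⟨r, hr⟩ | ⟨r, hr⟩
      · rw [← hr]; exact hq _ _ _
      · rw [← hr]; exact hp _
    · exact ⟨fun y hy hj => absurd ⟨y, hy, hj⟩ h, fun y _ hy hj => absurd ⟨y, hy, hj⟩ h⟩
  choose t ht using ht
  let S₁ : Set (FundamentalGroup X x) := ⋃ i, {g | ∃ h, g = t i x h (Joined.refl x)}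
  let S₂ : Set (FundamentalGroup X x) := ⋃ ij : ι × ι,
    {g | ∃ y hi hj h, g = t ij.1 y hi h ≫ Groupoid.inv (t ij.2 y hj h)}
  have hS₁ : S₁.Finite := by
    refine Set.finite_iUnion fun i => Set.Subsingleton.finite ?_
    rintro _ ⟨_, rfl⟩ _ ⟨_, rfl⟩
    rfl
  have hS₂ : S₂.Finite := by
    refine Set.finite_iUnion fun ij => Set.Subsingleton.finite ?_
    rintro _ ⟨y, hi, hj, h, rfl⟩ _ ⟨y', hi', hj', h', rfl⟩
    obtain ⟨p, hp1, hp2⟩ := hint ij.1 ij.2 y y' hi hj hi' hj'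
    rw [← ht ij.1 y y' hi h hi' h' p hp1, ← ht ij.2 y y' hj h hj' h' p hp2]
    simp
  let H := Subgroup.closure (S₁ ∪ S₂)
  have memS₁ : ∀ i h, (t i x h (Joined.refl x) : FundamentalGroup X x) ∈ H := fun i h =>
    Subgroup.subset_closure (Or.inl (Set.mem_iUnion.mpr ⟨i, h, rfl⟩))
  have memS₂ : ∀ i j y hi hj h,
      (t i y hi h ≫ Groupoid.inv (t j y hj h) : FundamentalGroup X x) ∈ H :=
    fun i j y hi hj h =>
      Subgroup.subset_closure (Or.inr (Set.mem_iUnion.mpr ⟨(i, j), y, hi, hj, h, rfl⟩))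
  have mulmem : ∀ f g : FundamentalGroup X x, f ∈ H → g ∈ H →
      (f ≫ g : FundamentalGroup X x) ∈ H := fun f g hf hg => H.mul_mem hg hf
  have invmem : ∀ f : FundamentalGroup X x, f ∈ H →
      (Groupoid.inv f : FundamentalGroup X x) ∈ H := fun f hf => H.inv_mem hf
  let Good : ∀ y, (FundamentalGroupoid.mk x ⟶ FundamentalGroupoid.mk y) → Prop :=
    fun y h => ∀ i hy hj, (h ≫ Groupoid.inv (t i y hy hj) : FundamentalGroup X x) ∈ H
  have main := path_induct U hU hcov
    (fun a b p => ∀ h, Good a h → Good b (h ≫ pathCls p))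
    (by
      intro a b c p q hp hq h hh
      rw [pathCls_trans, ← Category.assoc]
      exact hq _ (hp _ hh))
    (by
      intro a b p q hpq hp
      rw [← pathCls_eq hpq]
      exact hp)
    (by
      intro k a b p hp h hh i hb hj
      have ha : a ∈ U k := by simpa using hp 0
      have hbk : b ∈ U k := by simpa using hp 1
      have hja : Joined x a := hj.trans ⟨p.symm⟩
      have e : h ≫ pathCls p ≫ Groupoid.inv (t i b hb hj) =
          (h ≫ Groupoid.inv (t k a ha hja)) ≫ (t k b hbk hj ≫ Groupoid.inv (t i b hb hj)) := by
        rw [← ht k a b ha hja hbk hj p hp]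
        simp
      rw [Category.assoc, e]
      exact mulmem _ _ (hh k ha hja) (memS₂ _ _ _ _ _ _))
  have top : H = ⊤ := by
    rw [eq_top_iff]
    intro g _
    obtain ⟨p, hp⟩ := Path.Homotopic.Quotient.mk_surjective (FundamentalGroup.toPath g)
    have hg : g = pathCls p := hp.symm
    obtain ⟨i, hi⟩ := hcov x
    have h1 := main x x p (𝟙 _) (fun i hy hj => by
      rw [Category.id_comp]
      exact invmem _ (memS₁ i hy)) i hi (Joined.refl x)
    have h2 := mulmem _ _ h1 (memS₁ i hi)
    rw [hg]
    simpa using h2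
  rw [Group.fg_iff]
  exact ⟨S₁ ∪ S₂, top, hS₁.union hS₂⟩

/-- A space embedded in a real topological vector space as a finite union of open convex sets has
finitely generated fundamental groups. -/
theorem fundamentalGroup_fg_of_convex_cover {X E ι : Type*} [TopologicalSpace X] [Finite ι]
    [AddCommGroup E] [Module ℝ E] [TopologicalSpace E] [IsTopologicalAddGroup E]
    [ContinuousSMul ℝ E] (e : X → E) (he : Topology.IsEmbedding e) (V : ι → Set E)
    (hV : ∀ i, IsOpen (V i)) (hconv : ∀ i, Convex ℝ (V i)) (hsub : ∀ i, V i ⊆ Set.range e)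
    (hcov : ∀ x, ∃ i, e x ∈ V i) (x : X) : Group.FG (FundamentalGroup X x) := by
  refine fundamentalGroup_fg_of_cover (fun i => e ⁻¹' V i)
    (fun i => (hV i).preimage he.continuous) hcov ?_ ?_ x
  · intro i a b p q hp hq
    have ha : e a ∈ V i := by simpa using hp 0
    have him : e '' (e ⁻¹' V i) = V i := Set.image_preimage_eq_of_subset (hsub i)
    have hs : IsSimplyConnected (e ⁻¹' V i) := by
      rw [← he.isSimplyConnected_image, him]
      have : ContractibleSpace (V i) := (hconv i).contractibleSpace ⟨_, ha⟩
      exact SimplyConnectedSpace.ofContractible _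
    have := hs.simplyConnectedSpace
    have hb : e b ∈ V i := by simpa using hp 1
    let p' : Path (⟨a, ha⟩ : e ⁻¹' V i) ⟨b, hb⟩ :=
      { toFun := fun s => ⟨p s, hp s⟩
        continuous_toFun := p.continuous.subtype_mk _
        source' := Subtype.ext p.source
        target' := Subtype.ext p.target }
    let q' : Path (⟨a, ha⟩ : e ⁻¹' V i) ⟨b, hb⟩ :=
      { toFun := fun s => ⟨q s, hq s⟩
        continuous_toFun := q.continuous.subtype_mk _
        source' := Subtype.ext q.source
        target' := Subtype.ext q.target }
    exact (SimplyConnectedSpace.paths_homotopic p' q').map ⟨Subtype.val, continuous_subtype_val⟩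
  · intro i j a b hai haj hbi hbj
    have hc : IsPathConnected (V i ∩ V j) :=
      ((hconv i).inter (hconv j)).isPathConnected ⟨e a, hai, haj⟩
    have him : e '' (e ⁻¹' (V i ∩ V j)) = V i ∩ V j :=
      Set.image_preimage_eq_of_subset (Set.inter_subset_left.trans (hsub i))
    rw [← him, ← he.isInducing.isPathConnected_iff] at hc
    obtain ⟨p, hp⟩ := hc.joinedIn a ⟨hai, haj⟩ b ⟨hbi, hbj⟩
    exact ⟨p, fun t => (hp t).1, fun t => (hp t).2⟩

/-- Indices of the hyperplanes `z i = 0`, `z i = 1`, `z i = z j`. -/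
abbrev HypIdx (n : ℕ) := Fin n ⊕ Fin n ⊕ {p : Fin n × Fin n // p.1 ≠ p.2}

/-- The affine functions defining the hyperplanes. -/
def hypFun {n : ℕ} : HypIdx n → (Fin n → ℂ) → ℂ
  | Sum.inl i, z => z i
  | Sum.inr (Sum.inl i), z => z i - 1
  | Sum.inr (Sum.inr p), z => z p.1.1 - z p.1.2

theorem hypFun_continuous {n : ℕ} (j : HypIdx n) : Continuous (hypFun j) := by
  rcases j with i | i | p
  · exact continuous_apply i
  · exact (continuous_apply i).sub continuous_const
  · exact (continuous_apply p.1.1).sub (continuous_apply p.1.2)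

theorem hypFun_affine {n : ℕ} (j : HypIdx n) (x y : Fin n → ℂ) (a b : ℝ) (hab : a + b = 1) :
    hypFun j (a • x + b • y) = a * hypFun j x + b * hypFun j y := by
  have hab' : (a : ℂ) + b = 1 := by exact_mod_cast hab
  rcases j with i | i | p <;> simp [hypFun]
  · linear_combination hab'
  · ring

/-- One of the four half planes covering the punctured plane. -/
theorem exists_halfplane (w : ℂ) (hw : w ≠ 0) : ∃ c : Fin 4, 0 < (w * Complex.I ^ (c : ℕ)).re := by
  by_contra! h
  have h0 := h 0
  have h1 := h 1
  have h2 := h 2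
  have h3 := h 3
  simp [pow_succ] at h0 h1 h2 h3
  exact hw (Complex.ext (by simp; linarith) (by simp; linarith))

/-- The configuration space of `n` labelled points in the twice punctured plane
`ℂ ∖ {0,1}`, topologized as a subspace of the product, has finitely generated
fundamental group (for every choice of basepoint). -/
theorem configurationSpace_twicePuncturedPlane_fg (n : ℕ) (hn : 1 ≤ n)
    (c : {f : Fin n → {z : ℂ // z ≠ 0 ∧ z ≠ 1} // Function.Injective f}) :
    Group.FG
      (FundamentalGroup {f : Fin n → {z : ℂ // z ≠ 0 ∧ z ≠ 1} // Function.Injective f} c) := by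
  have he : Topology.IsEmbedding
      (fun (f : {f : Fin n → {z : ℂ // z ≠ 0 ∧ z ≠ 1} // Function.Injective f}) (i : Fin n) =>
        (f.1 i : ℂ)) :=
    (Topology.IsEmbedding.piMap (fun _ : Fin n => Topology.IsEmbedding.subtypeVal)).comp
      Topology.IsEmbedding.subtypeVal
  refine fundamentalGroup_fg_of_convex_cover (ι := HypIdx n → Fin 4) _ he
    (fun s => {z | ∀ j, 0 < (hypFun j z * Complex.I ^ (s j : ℕ)).re}) ?_ ?_ ?_ ?_ c
  · intro s
    simp only [Set.ofPred_forall]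
    refine isOpen_iInter_of_finite fun j => isOpen_lt continuous_const ?_
    exact Complex.continuous_re.comp ((hypFun_continuous j).mul continuous_const)
  · intro s x hx y hy a b ha hb hab j
    have h1 := hx j
    have h2 := hy j
    rw [hypFun_affine j x y a b hab, add_mul, mul_assoc, mul_assoc, Complex.add_re,
      Complex.re_ofReal_mul, Complex.re_ofReal_mul]
    rcases ha.eq_or_lt with rfl | ha
    · have : b = 1 := by linarith
      subst this
      simpa using h2
    · have := mul_pos ha h1
      have := mul_nonneg hb h2.le
      linarith
  · intro s z hz
    have hne : ∀ j, hypFun j z ≠ 0 := by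
      intro j hj
      have := hz j
      simp [hj] at this
    refine ⟨⟨fun i => ⟨z i, hne (Sum.inl i), fun h => hne (Sum.inr (Sum.inl i)) ?_⟩, ?_⟩, rfl⟩
    · simp [hypFun, h]
    · intro i j hij
      by_contra hne'
      refine hne (Sum.inr (Sum.inr ⟨(i, j), hne'⟩)) ?_
      have : z i = z j := congrArg Subtype.val hij
      simp [hypFun, this]
  · intro f
    have hne : ∀ j, hypFun j (fun i => (f.1 i : ℂ)) ≠ 0 := by
      rintro (i | i | ⟨⟨i, j⟩, hij⟩)
      · exact (f.1 i).2.1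
      · exact sub_ne_zero.mpr (f.1 i).2.2
      · exact sub_ne_zero.mpr fun h => hij (f.2 (Subtype.ext h))
    choose s hs using fun j => exists_halfplane _ (hne j)
    exact ⟨s, hs⟩
end

section
/- Let X := {z ∈ ℂ : z ≠ 0 and z ≠ 1} with the subspace topology. Then for every basepoint x ∈ X, the fundamental group π₁(X, x) is isomorphic to the free group on two generators. (Since the moduli space M_{0,4} is isomorphic to ℂ∖{0,1}, this is the statement of the appendix that the genus zero mapping class group Γ_{0,4} is free of rank 2.) -/
open CategoryTheory Topology unitInterval

noncomputable section

namespace TwicePunctured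

section general

variable {Y : Type} [TopologicalSpace Y]

/-- The class of a path as a morphism of the fundamental groupoid. -/
def hom {x y : Y} (p : Path x y) : FundamentalGroupoid.mk x ⟶ FundamentalGroupoid.mk y :=
  Path.Homotopic.Quotient.mk p

theorem hom_eq {x y : Y} {p q : Path x y} (h : p.Homotopic q) : hom p = hom q :=
  Path.Homotopic.Quotient.eq.2 h

theorem hom_trans {x y z : Y} (p : Path x y) (q : Path y z) :
    hom (p.trans q) = hom p ≫ hom q := rfl

theorem hom_symm {x y : Y} (p : Path x y) : hom p.symm = Groupoid.inv (hom p) := rfl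

theorem hom_refl {x : Y} : hom (Path.refl x) = 𝟙 _ := rfl

/-- A covering of a space by two open sets with trivial path groupoids, with locally
constant transition function in a free group. -/
structure Cover (Y : Type) [TopologicalSpace Y] (ι : Type) where
  U : Bool → Set Y
  isOpen_U : ∀ e, IsOpen (U e)
  cover : ∀ y, ∃ e, y ∈ U e
  homotopic : ∀ e (x y : Y) (p q : Path x y), (∀ t, p t ∈ U e) → (∀ t, q t ∈ U e) → p.Homotopic q
  joined : ∀ e (x y : Y), x ∈ U e → y ∈ U e → ∃ p : Path x y, ∀ t, p t ∈ U e
  b : Y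
  s : ι → Y
  hb : ∀ e, b ∈ U e
  hs : ∀ i e, s i ∈ U e
  c : Y → FreeGroup ι
  c_loc : ∀ y, (∀ e, y ∈ U e) → ∀ᶠ z in 𝓝 y, c z = c y
  c_b : c b = 1
  c_s : ∀ i, c (s i) = FreeGroup.of i
  comp : ∀ y, (∀ e, y ∈ U e) →
    (∃ p : Path b y, ∀ e t, p t ∈ U e) ∨ ∃ i, ∃ p : Path (s i) y, ∀ e t, p t ∈ U e

variable {ι : Type} (C : Cover Y ι)

theorem bool_third {a b c : Bool} (h : ¬ a = b) (h' : ¬ c = b) : a = c := by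
  revert a b c
  decide

namespace Cover

/-- A path from the base point inside one of the two sets. -/
def P (e : Bool) (y : Y) (h : y ∈ C.U e) : Path C.b y := (C.joined e C.b y (C.hb e) h).choose

theorem P_mem (e : Bool) (y : Y) (h : y ∈ C.U e) (t : I) : C.P e y h t ∈ C.U e :=
  (C.joined e C.b y (C.hb e) h).choose_spec t

theorem trans_mem {A : Set Y} {x y z : Y} (p : Path x y) (q : Path y z) (hp : ∀ t, p t ∈ A)
    (hq : ∀ t, q t ∈ A) (t : I) : p.trans q t ∈ A := by
  rw [Path.trans_apply]
  split_ifs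
  · exact hp _
  · exact hq _

theorem transport (e : Bool) {x y : Y} (hx : x ∈ C.U e) (hy : y ∈ C.U e) (r : Path x y)
    (hr : ∀ t, r t ∈ C.U e) : hom (C.P e x hx) ≫ hom r = hom (C.P e y hy) := by
  rw [← hom_trans]
  exact hom_eq (C.homotopic e _ _ _ _ (trans_mem _ _ (C.P_mem e x hx) hr) (C.P_mem e y hy))

theorem P_b (e : Bool) (h : C.b ∈ C.U e) : hom (C.P e C.b h) = 𝟙 _ := by
  rw [← hom_refl]
  exact hom_eq (C.homotopic e _ _ _ _ (C.P_mem e _ h) (fun _ => h))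

/-- The generators. -/
def gen (i : ι) : FundamentalGroup Y C.b :=
  hom (C.P true (C.s i) (C.hs i true)) ≫ Groupoid.inv (hom (C.P false (C.s i) (C.hs i false)))

/-- The comparison homomorphism. -/
def psi : FreeGroup ι →* FundamentalGroup Y C.b := FreeGroup.lift C.gen

theorem cocycle (y : Y) (h : ∀ e, y ∈ C.U e) : ∃ g ∈ C.psi.range,
    hom (C.P true y (h true)) ≫ Groupoid.inv (hom (C.P false y (h false))) = g := by
  refine ⟨_, ?_, rfl⟩
  rcases C.comp y h with ⟨p, hp⟩ | ⟨i, p, hp⟩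
  · rw [← C.transport true (C.hb true) (h true) p (hp true),
      ← C.transport false (C.hb false) (h false) p (hp false), P_b, P_b]
    simp only [Category.id_comp, Groupoid.inv_eq_inv, IsIso.hom_inv_id]
    exact one_mem _
  · rw [← C.transport true (C.hs i true) (h true) p (hp true),
      ← C.transport false (C.hs i false) (h false) p (hp false)]
    refine ⟨FreeGroup.of i, ?_⟩
    simp only [psi, FreeGroup.lift_apply_of, gen, Groupoid.inv_eq_inv, IsIso.inv_comp,
      Category.assoc, IsIso.hom_inv_id_assoc]

/-- The initial part of a loop. -/
def ini (γ : Path C.b C.b) (t : I) : Path C.b (γ t) := (γ.subpath 0 t).cast γ.source.symm rfl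

theorem ini_trans (γ : Path C.b C.b) (t s : I) :
    hom (C.ini γ t) ≫ hom (γ.subpath t s) = hom (C.ini γ s) := by
  rw [← hom_trans]
  refine hom_eq ?_
  exact Path.Homotopic.pathCast ⟨Path.Homotopy.subpathTransSubpath γ 0 t s⟩ γ.source.symm rfl

/-- The loop obtained by closing up an initial part. -/
def clo (γ : Path C.b C.b) (e : Bool) (t : I) (h : γ t ∈ C.U e) : FundamentalGroup Y C.b :=
  hom (C.ini γ t) ≫ Groupoid.inv (hom (C.P e _ h))

theorem clo_change (γ : Path C.b C.b) (t : I) (h : ∀ e, γ t ∈ C.U e) (e e' : Bool)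
    (hm : C.clo γ e t (h e) ∈ C.psi.range) : C.clo γ e' t (h e') ∈ C.psi.range := by
  obtain ⟨g, hg, hg'⟩ := C.cocycle (γ t) h
  have key : g * C.clo γ true t (h true) = C.clo γ false t (h false) := by
    rw [← hg', End.mul_def, clo, clo]
    simp only [Groupoid.inv_eq_inv, Category.assoc, IsIso.inv_hom_id_assoc]
  cases e <;> cases e'
  · exact hm
  · rw [← key] at hm
    exact (Subgroup.mul_mem_cancel_left _ hg).1 hm
  · rw [← key]
    exact mul_mem hg hm
  · exact hm

theorem clo_const (γ : Path C.b C.b) (e : Bool) (t s : I) (ht : γ t ∈ C.U e) (hs : γ s ∈ C.U e)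
    (hr : ∀ u, γ.subpath t s u ∈ C.U e) : C.clo γ e s hs = C.clo γ e t ht := by
  rw [clo, clo, ← C.ini_trans γ t s, ← C.transport e ht hs _ hr]
  simp only [Groupoid.inv_eq_inv, IsIso.inv_comp,
      Category.assoc, IsIso.hom_inv_id_assoc]

theorem clo_end {y : Y} (hy : C.b = y) (q : Path C.b y) (e : Bool) (h : y ∈ C.U e) 
    (hm : (hom q ≫ Groupoid.inv (hom (C.P e y h)) : FundamentalGroup Y C.b) ∈ C.psi.range) :
    (hom (q.cast rfl hy) : FundamentalGroup Y C.b) ∈ C.psi.range := by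
  subst hy
  rw [P_b, Groupoid.inv_eq_inv, IsIso.inv_id, Category.comp_id] at hm
  exact hm

theorem psi_surjective : Function.Surjective C.psi := by
  rw [← MonoidHom.range_eq_top, Subgroup.eq_top_iff']
  intro g
  obtain ⟨γ, rfl⟩ := Path.Homotopic.Quotient.mk_surjective g
  let Q : I → Prop := fun t => ∃ e h, C.clo γ e t h ∈ C.psi.range
  have hQ : IsLocallyConstant Q := by
    rw [IsLocallyConstant.iff_eventually_eq]
    intro t
    obtain ⟨e, he⟩ := C.cover (γ t)
    have h1 : ∀ᶠ s in 𝓝 t, ∀ u ∈ Set.uIcc t s, γ u ∈ C.U e := by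
      have hN : γ ⁻¹' (C.U e) ∈ 𝓝 t := ((C.isOpen_U e).preimage γ.continuous).mem_nhds he
      have ht : Filter.Tendsto (fun s : I => Set.uIcc t s) (𝓝 t) (𝓝 t).smallSets :=
        tendsto_const_nhds.uIcc Filter.tendsto_id
      exact ht.eventually (Filter.eventually_smallSets_subset.2 hN)
    have h2 (s) (hs : γ s ∈ C.U e) : Q s ↔ C.clo γ e s hs ∈ C.psi.range := by
      refine ⟨fun ⟨e', h', hm⟩ => ?_, fun h => ⟨e, hs, h⟩⟩
      by_cases hee : e' = e
      · subst hee; exact hm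
      · have hall : ∀ e'', γ s ∈ C.U e'' := by
          intro e''
          by_cases h3 : e'' = e
          · rwa [h3]
          · have : e'' = e' := bool_third h3 hee
            rwa [this]
        exact C.clo_change γ s hall e' e hm
    filter_upwards [h1] with s hs
    have hss := hs s Set.right_mem_uIcc
    refine propext ?_
    rw [h2 s hss, h2 t he, C.clo_const γ e t s he hss]
    intro u
    have : γ.subpath t s u ∈ Set.range (γ.subpath t s) := ⟨u, rfl⟩
    rw [Path.range_subpath] at this
    obtain ⟨v, hv, hv'⟩ := this
    rw [← hv']
    exact hs v hv
  have hQ0 : Q 0 := by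
    refine ⟨true, by simpa using C.hb true, ?_⟩
    have : hom (C.ini γ 0) = hom (C.P true (γ 0) (by simpa using C.hb true)) := by
      refine hom_eq (C.homotopic true _ _ _ _ (fun u => ?_) (C.P_mem true _ _))
      simpa [ini] using C.hb true
    rw [clo, this, Groupoid.inv_eq_inv, IsIso.hom_inv_id]
    exact one_mem _
  have hQ1 : Q 1 := by rwa [hQ.apply_eq_of_preconnectedSpace 1 0]
  obtain ⟨e, h, hm⟩ := hQ1
  have := C.clo_end γ.target.symm (C.ini γ 1) e h hm
  have h3 : (C.ini γ 1).cast rfl γ.target.symm = γ := by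
    ext t
    simp [ini]
  rw [h3] at this
  exact this

/-- The left translation cocycle in the two charts. -/
def h (e : Bool) (y : Y) : FreeGroup ι := if e then 1 else C.c y

open Classical in
/-- A chart around each point. -/
def idx (y : Y) : Bool := (C.cover y).choose

theorem idx_mem (y : Y) : y ∈ C.U (C.idx y) := (C.cover y).choose_spec

instance : TopologicalSpace (FreeGroup ι) := ⊥

instance : DiscreteTopology (FreeGroup ι) := ⟨rfl⟩

/-- The covering space with fibre the free group. -/
def Z : FiberBundleCore Bool Y (FreeGroup ι) where
  baseSet := C.U
  isOpen_baseSet := C.isOpen_U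
  indexAt := C.idx
  mem_baseSet_at := C.idx_mem
  coordChange i j y v := C.h j y * ((C.h i y)⁻¹ * v)
  coordChange_self i y _ v := by simp
  coordChange_comp i j k y _ v := by simp
  continuousOn_coordChange i j := by
    rintro ⟨y, v⟩ ⟨⟨hi, hj⟩, -⟩
    apply ContinuousAt.continuousWithinAt
    by_cases hij : i = j
    · subst hij
      simpa using continuousAt_snd
    · have hall : ∀ e, y ∈ C.U e := by
        intro e
        by_cases he : e = i
        · rwa [he]
        · have : e = j := bool_third he (Ne.symm hij)
          rwa [this]
      have hh : ∀ e, ∀ᶠ z in 𝓝 y, C.h e z = C.h e y := by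
        intro e
        cases e
        · simpa [h] using C.c_loc y hall
        · simp [h]
      have h1 : ContinuousAt
          (fun p : Y × FreeGroup ι => C.h j y * ((C.h i y)⁻¹ * p.2)) (y, v) :=
        (continuous_of_discreteTopology (f := fun w : FreeGroup ι =>
          C.h j y * ((C.h i y)⁻¹ * w))).continuousAt.comp continuousAt_snd
      refine h1.congr ?_
      filter_upwards [continuousAt_fst.eventually (hh i), continuousAt_fst.eventually (hh j)]
        with p hp hq
      rw [hp, hq]

theorem isCov : IsCoveringMap C.Z.proj :=
  FiberBundle.isCoveringMap (F := FreeGroup ι) (E := C.Z.Fiber)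

/-- Points of the fibre in the global coordinate. -/
def pt (y : Y) (v : FreeGroup ι) : C.Z.proj ⁻¹' {y} := ⟨⟨y, C.h (C.idx y) y * v⟩, rfl⟩

theorem pt_injective (y : Y) : Function.Injective (C.pt y) := by
  intro v w hvw
  have := congrArg Subtype.val hvw
  simp only [pt] at this
  injection this with _ h2
  exact mul_left_cancel h2

theorem monodromy_pt (e : Bool) {x y : Y} (p : Path x y) (hp : ∀ t, p t ∈ C.U e)
    (v : FreeGroup ι) : C.isCov.monodromy (Path.Homotopic.Quotient.mk p) (C.pt x v) =
      C.pt y ((C.h e y)⁻¹ * (C.h e x * v)) := by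
  let Γ : I → C.Z.TotalSpace := fun t =>
    ⟨p t, C.h (C.idx (p t)) (p t) * ((C.h e (p t))⁻¹ * (C.h e x * v))⟩
  have hΓ : Continuous Γ := by
    have h1 : Γ = (C.Z.localTriv e).toOpenPartialHomeomorph.symm ∘
        (fun t => (p t, C.h e x * v)) := by
      funext t
      rfl
    rw [h1]
    refine (C.Z.localTriv e).toOpenPartialHomeomorph.continuousOn_symm.comp_continuous
      (by fun_prop) (fun t => ?_)
    rw [(C.Z.localTriv e).target_eq]
    exact ⟨hp t, trivial⟩
  have h2 := (C.isCov.eq_liftPath_iff (γ := (p : C(I, Y))) (e := (C.pt x v).1)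
    (p.source.trans (C.pt x v).2.symm) (Γ := Γ)).2 ⟨hΓ, by funext t; rfl, by
      simp only [Γ, pt]
      rw [p.source]
      simp⟩
  apply Subtype.ext
  have h3 := congrFun h2 1
  refine h3.symm.trans ?_
  simp only [Γ, pt]
  rw [p.target]

theorem monodromy_gen (i : ι) (v : FreeGroup ι) :
    C.isCov.monodromyPerm C.b (C.gen i) (C.pt C.b v) = C.pt C.b (FreeGroup.of i * v) := by
  rw [IsCoveringMap.coe_monodromyPerm]
  have : C.gen i = Path.Homotopic.Quotient.trans
    (Path.Homotopic.Quotient.mk (C.P true (C.s i) (C.hs i true)))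
    (Path.Homotopic.Quotient.mk (C.P false (C.s i) (C.hs i false)).symm) := rfl
  rw [this, IsCoveringMap.monodromy_trans_apply, C.monodromy_pt true _ (C.P_mem _ _ _),
    C.monodromy_pt false (C.P false (C.s i) (C.hs i false)).symm (fun t => C.P_mem _ _ _ _)]
  simp [h, C.c_b, C.c_s]

theorem monodromy_psi (w v : FreeGroup ι) :
    C.isCov.monodromyPerm C.b (C.psi w) (C.pt C.b v) = C.pt C.b (w * v) := by
  induction w using FreeGroup.induction_on generalizing v with
  | C1 => rw [map_one, map_one, one_mul]; rfl
  | of i => simpa [psi] using C.monodromy_gen i v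
  | inv_of i _ =>
    rw [map_inv, map_inv, Equiv.Perm.inv_eq_iff_eq]
    simpa [psi] using (C.monodromy_gen i ((FreeGroup.of i)⁻¹ * v)).symm
  | mul x y hx hy => rw [map_mul, map_mul, Equiv.Perm.mul_apply, hy, hx, mul_assoc]

theorem psi_injective : Function.Injective C.psi := by
  intro w w' hw
  have h1 := C.monodromy_psi w 1
  rw [hw, C.monodromy_psi w' 1] at h1
  simpa using (C.pt_injective _ h1).symm

/-- The fundamental group is free. -/
def equiv : FreeGroup ι ≃* FundamentalGroup Y C.b :=
  MulEquiv.ofBijective C.psi ⟨C.psi_injective, C.psi_surjective⟩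

end Cover
end general

/-- The twice punctured plane. -/
abbrev X : Type := {z : ℂ // z ≠ 0 ∧ z ≠ 1}

section star

variable {S : Set ℂ} {c : ℂ}

theorem star_homotopic (hS : StarConvex ℝ c S) (hX : ∀ z ∈ S, z ≠ 0 ∧ z ≠ 1) (x y : X)
    (p q : Path x y) (hp : ∀ t, (p t).1 ∈ S) (hq : ∀ t, (q t).1 ∈ S) : p.Homotopic q := by
  have hx : x.1 ∈ S := by simpa using hp 0
  have hy : y.1 ∈ S := by simpa using hp 1
  have := hS.contractibleSpace ⟨_, hx⟩
  let f : C(S, X) := ⟨fun z => ⟨z.1, hX z.1 z.2⟩, by fun_prop⟩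
  let p' : Path (⟨x.1, hx⟩ : S) ⟨y.1, hy⟩ :=
    ⟨⟨fun t => ⟨(p t).1, hp t⟩, by fun_prop⟩, by simp, by simp⟩
  let q' : Path (⟨x.1, hx⟩ : S) ⟨y.1, hy⟩ :=
    ⟨⟨fun t => ⟨(q t).1, hq t⟩, by fun_prop⟩, by simp, by simp⟩
  exact (SimplyConnectedSpace.paths_homotopic p' q').map f

theorem star_joined (hS : StarConvex ℝ c S) (hX : ∀ z ∈ S, z ≠ 0 ∧ z ≠ 1) (x y : X)
    (hx : x.1 ∈ S) (hy : y.1 ∈ S) : ∃ p : Path x y, ∀ t, (p t).1 ∈ S := by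
  have := hS.contractibleSpace ⟨_, hx⟩
  let f : C(S, X) := ⟨fun z => ⟨z.1, hX z.1 z.2⟩, by fun_prop⟩
  let p' : Path (⟨x.1, hx⟩ : S) ⟨y.1, hy⟩ := PathConnectedSpace.somePath _ _
  exact ⟨p'.map f.continuous, fun t => (p' t).2⟩

end star

/-- A sign. -/
def sg (e : Bool) : ℝ := if e then 1 else -1

/-- The plane minus two rays. -/
def A (e : Bool) : Set ℂ :=
  {z | ¬ (sg e * z.im = 2 * z.re ∧ z.re ≤ 0) ∧ ¬ (sg e * z.im = 2 - 2 * z.re ∧ 1 ≤ z.re)}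

/-- The left wedge. -/
def L : Set ℂ := {z | |z.im| < - 2 * z.re}

/-- The right wedge. -/
def R : Set ℂ := {z | |z.im| < 2 * z.re - 2}

/-- The middle part. -/
def M : Set ℂ := {z | - 2 * z.re < |z.im| ∧ 2 * z.re - 2 < |z.im|}

theorem sg_sq (e : Bool) : sg e * sg e = 1 := by cases e <;> simp [sg]

theorem A_ne (e : Bool) (z : ℂ) (hz : z ∈ A e) : z ≠ 0 ∧ z ≠ 1 := by
  constructor
  · rintro rfl
    exact hz.1 (by simp)
  · rintro rfl
    exact hz.2 (by simp)

theorem A_star (e : Bool) : StarConvex ℝ (⟨1 / 2, sg e⟩ : ℂ) (A e) := by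
  intro z hz a b ha hb hab
  obtain rfl : a = 1 - b := by linarith
  have hs := sg_sq e
  rcases hb.eq_or_lt with rfl | hb
  · simp only [A, Set.mem_setOf_eq, sub_zero, one_smul, zero_smul, add_zero]
    exact ⟨fun h => by linarith [h.2], fun h => by linarith [h.2]⟩
  · simp only [A, Set.mem_setOf_eq, Complex.add_re, Complex.add_im, Complex.smul_re,
      Complex.smul_im, smul_eq_mul] at hz ⊢
    refine ⟨fun h => hz.1 ⟨?_, ?_⟩, fun h => hz.2 ⟨?_, ?_⟩⟩
    · refine mul_left_cancel₀ hb.ne' ?_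
      linear_combination h.1 - (1 - b) * hs
    · by_contra hn
      nlinarith [h.2]
    · refine mul_left_cancel₀ hb.ne' ?_
      linear_combination h.1 - (1 - b) * hs
    · by_contra hn
      nlinarith [h.2]

theorem A_open (e : Bool) : IsOpen (A e) := by
  have h1 : IsClosed {z : ℂ | sg e * z.im = 2 * z.re} := isClosed_eq (by fun_prop) (by fun_prop)
  have h2 : IsClosed {z : ℂ | z.re ≤ 0} := isClosed_le (by fun_prop) (by fun_prop)
  have h3 : IsClosed {z : ℂ | sg e * z.im = 2 - 2 * z.re} :=
    isClosed_eq (by fun_prop) (by fun_prop)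
  have h4 : IsClosed {z : ℂ | (1 : ℝ) ≤ z.re} := isClosed_le (by fun_prop) (by fun_prop)
  exact (h1.inter h2).isOpen_compl.inter (h3.inter h4).isOpen_compl

theorem L_open : IsOpen L := isOpen_lt (by fun_prop) (by fun_prop)
theorem R_open : IsOpen R := isOpen_lt (by fun_prop) (by fun_prop)
theorem M_open : IsOpen M := by
  have h1 : IsOpen {z : ℂ | - 2 * z.re < |z.im|} := isOpen_lt (by fun_prop) (by fun_prop)
  have h2 : IsOpen {z : ℂ | 2 * z.re - 2 < |z.im|} := isOpen_lt (by fun_prop) (by fun_prop)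
  exact h1.inter h2

theorem sg_mul_abs (e : Bool) (y : ℝ) : |sg e * y| = |y| := by cases e <;> simp [sg]

theorem mem_A_of (z : ℂ) (h1 : |z.im| ≠ - 2 * z.re) (h2 : |z.im| ≠ 2 * z.re - 2) (e : Bool) :
    z ∈ A e := by
  refine ⟨fun h => h1 ?_, fun h => h2 ?_⟩
  · rw [← sg_mul_abs e, h.1, abs_of_nonpos (by linarith [h.2])]
    ring
  · rw [← sg_mul_abs e, h.1, abs_of_nonpos (by linarith [h.2])]
    ring

theorem L_sub (z : ℂ) (h : z ∈ L) (e : Bool) : z ∈ A e := by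
  have h' : |z.im| < - 2 * z.re := h
  have := abs_nonneg z.im
  exact mem_A_of z (by linarith) (by intro h3; linarith) e

theorem R_sub (z : ℂ) (h : z ∈ R) (e : Bool) : z ∈ A e := by
  have h' : |z.im| < 2 * z.re - 2 := h
  have := abs_nonneg z.im
  exact mem_A_of z (by intro h3; linarith) (by linarith) e

theorem M_sub (z : ℂ) (h : z ∈ M) (e : Bool) : z ∈ A e := mem_A_of z h.1.ne' h.2.ne' e

theorem sub_LRM (z : ℂ) (h : ∀ e, z ∈ A e) : z ∈ L ∨ z ∈ R ∨ z ∈ M := by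
  have h0 := h true
  have h1 := h false
  simp only [A, sg, Set.mem_setOf_eq, if_true, one_mul] at h0 h1
  simp only [L, R, M, Set.mem_setOf_eq]
  by_contra! hn
  obtain ⟨hL, hR, hM⟩ := hn
  rcases abs_cases z.im with ⟨ha, hb⟩ | ⟨ha, hb⟩ <;> grind

theorem L_star : StarConvex ℝ (⟨-1, 0⟩ : ℂ) L := by
  intro z hz a b ha hb hab
  have hz' : |z.im| < - 2 * z.re := hz
  simp only [L, Set.mem_setOf_eq, Complex.add_re, Complex.add_im, Complex.smul_re,
      Complex.smul_im, smul_eq_mul, mul_zero, zero_add, abs_mul, abs_of_nonneg hb]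
  rcases hb.eq_or_lt with rfl | hb
  · linarith
  · nlinarith

theorem R_star : StarConvex ℝ (⟨2, 0⟩ : ℂ) R := by
  intro z hz a b ha hb hab
  obtain rfl : a = 1 - b := by linarith
  have hz' : |z.im| < 2 * z.re - 2 := hz
  simp only [R, Set.mem_setOf_eq, Complex.add_re, Complex.add_im, Complex.smul_re,
      Complex.smul_im, smul_eq_mul, mul_zero, zero_add, abs_mul, abs_of_nonneg hb]
  rcases hb.eq_or_lt with rfl | hb
  · linarith
  · nlinarith

theorem M_star : StarConvex ℝ (⟨1 / 2, 0⟩ : ℂ) M := by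
  intro z hz a b ha hb hab
  obtain rfl : a = 1 - b := by linarith
  obtain ⟨h1, h2⟩ : - 2 * z.re < |z.im| ∧ 2 * z.re - 2 < |z.im| := hz
  simp only [M, Set.mem_setOf_eq, Complex.add_re, Complex.add_im, Complex.smul_re,
      Complex.smul_im, smul_eq_mul, mul_zero, zero_add, abs_mul, abs_of_nonneg hb]
  rcases hb.eq_or_lt with rfl | hb
  · constructor <;> linarith
  · constructor <;> nlinarith

open Classical in
/-- The transition function. -/
def tr (z : X) : FreeGroup (Fin 2) :=
  if z.1 ∈ L then FreeGroup.of 0 else if z.1 ∈ R then FreeGroup.of 1 else 1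

theorem L_not_R (z : ℂ) (h : z ∈ L) : z ∉ R := by
  intro h2
  have h' : |z.im| < - 2 * z.re := h
  have h2' : |z.im| < 2 * z.re - 2 := h2
  have := abs_nonneg z.im
  linarith

theorem M_not_L (z : ℂ) (h : z ∈ M) : z ∉ L := fun h2 => lt_asymm h.1 h2

theorem M_not_R (z : ℂ) (h : z ∈ M) : z ∉ R := fun h2 => lt_asymm h.2 h2

theorem tr_L (z : X) (h : z.1 ∈ L) : tr z = FreeGroup.of 0 := by simp [tr, h]

theorem tr_R (z : X) (h : z.1 ∈ R) : tr z = FreeGroup.of 1 := by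
  have : z.1 ∉ L := fun h' => L_not_R _ h' h
  simp [tr, h, this]

theorem tr_M (z : X) (h : z.1 ∈ M) : tr z = 1 := by simp [tr, M_not_L _ h, M_not_R _ h]

/-- Base point. -/
def pb : X := ⟨⟨1 / 2, 0⟩, by simp [Complex.ext_iff], by norm_num [Complex.ext_iff]⟩

/-- Points in the wedges. -/
def ps : Fin 2 → X := ![⟨⟨-1, 0⟩, by simp [Complex.ext_iff], by norm_num [Complex.ext_iff]⟩,
  ⟨⟨2, 0⟩, by simp [Complex.ext_iff], by norm_num [Complex.ext_iff]⟩]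

theorem pb_M : pb.1 ∈ M := by norm_num [pb, M]

theorem ps_L : (ps 0).1 ∈ L := by norm_num [ps, L]

theorem ps_R : (ps 1).1 ∈ R := by norm_num [ps, R]

theorem tr_loc_aux {S : Set ℂ} (hS : IsOpen S) (g : FreeGroup (Fin 2))
    (h : ∀ z : X, z.1 ∈ S → tr z = g) (y : X) (hy : y.1 ∈ S) : ∀ᶠ z in 𝓝 y, tr z = tr y := by
  have h1 : ∀ᶠ z : X in 𝓝 y, z.1 ∈ S := (hS.preimage continuous_subtype_val).mem_nhds hy
  filter_upwards [h1] with z hz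
  rw [h z hz, h y hy]

/-- The covering data for the twice punctured plane. -/
def cov : Cover X (Fin 2) where
  U e := {z | z.1 ∈ A e}
  isOpen_U e := (A_open e).preimage continuous_subtype_val
  cover y := by
    by_contra! hn
    have h0 := hn true
    have h1 := hn false
    have hy := y.2
    simp only [Set.mem_setOf_eq, A, sg, if_true, one_mul, Complex.ext_iff, Ne] at h0 h1 hy
    simp at h1 hy
    grind
  homotopic e := star_homotopic (A_star e) (A_ne e)
  joined e := star_joined (A_star e) (A_ne e)
  b := pb
  s := ps
  hb e := M_sub _ pb_M e
  hs i e := by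
    fin_cases i
    · exact L_sub _ ps_L e
    · exact R_sub _ ps_R e
  c := tr
  c_loc y hy := by
    rcases sub_LRM y.1 hy with h | h | h
    · exact tr_loc_aux L_open _ tr_L y h
    · exact tr_loc_aux R_open _ tr_R y h
    · exact tr_loc_aux M_open _ tr_M y h
  c_b := tr_M _ pb_M
  c_s i := by
    fin_cases i
    · exact tr_L _ ps_L
    · exact tr_R _ ps_R
  comp y hy := by
    rcases sub_LRM y.1 hy with h | h | h
    · obtain ⟨p, hp⟩ := star_joined L_star (fun z hz => A_ne true z (L_sub z hz true)) _ y ps_L h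
      exact Or.inr ⟨0, p, fun e t => L_sub _ (hp t) e⟩
    · obtain ⟨p, hp⟩ := star_joined R_star (fun z hz => A_ne true z (R_sub z hz true)) _ y ps_R h
      exact Or.inr ⟨1, p, fun e t => R_sub _ (hp t) e⟩
    · obtain ⟨p, hp⟩ := star_joined M_star (fun z hz => A_ne true z (M_sub z hz true)) _ y pb_M h
      exact Or.inl ⟨p, fun e t => M_sub _ (hp t) e⟩

end TwicePunctured

end

/-- The fundamental group of the twice punctured plane `ℂ ∖ {0,1}` (a model for the
moduli space `M_{0,4}`) is free on two generators; hence the genus zero mapping class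
group `Γ_{0,4}` is free of rank `2`. -/
theorem fundamentalGroup_twicePuncturedPlane_free
    (x : {z : ℂ // z ≠ 0 ∧ z ≠ 1}) :
    Nonempty (FundamentalGroup {z : ℂ // z ≠ 0 ∧ z ≠ 1} x ≃* FreeGroup (Fin 2)) := by
  obtain ⟨e, he⟩ := TwicePunctured.cov.cover x
  exact ⟨(FundamentalGroup.fundamentalGroupMulEquivOfPath
    (TwicePunctured.cov.P e x he)).symm.trans TwicePunctured.cov.equiv.symm⟩
end
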